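/- arXiv:2108.00431 — 2 statements merged into one kernel-verified Lean document; each statement's English description precedes it below -/
import Mathlib

section
/- Let (a_n) be lacunary with constant c > 1 and let r ≥ 1 be an integer, ε > 0. For any M ≥ 1 and K ≥ 1, the number of tuples (y_1,...,y_r,z_1,...,z_r) ∈ ℤ^{2r} with |y_i| ≤ M for all i, 1 ≤ z_1,...,z_r ≤ M distinct, (y_1,...,y_r) ≠ (0,...,0), |y_1 a_{z_1} + ... + y_r a_{z_r}| ≤ K, and y_1 + ... + y_r = 0, is O(K^r · M^{r-1+ε}), with implied constant depending only on r, c, a_1 and ε. -/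
/-- `S` is contained in a finite set with at most `B` elements. -/
def Cnt {α : Type*} (S : Set α) (B : ℝ) : Prop := ∃ s : Finset α, S ⊆ ↑s ∧ (s.card : ℝ) ≤ B

theorem Cnt.mono {α : Type*} {S T : Set α} {B C : ℝ} (h : Cnt T C) (hS : S ⊆ T) (hB : C ≤ B) :
    Cnt S B := by
  obtain ⟨s, h1, h2⟩ := h
  exact ⟨s, hS.trans h1, h2.trans hB⟩

theorem Cnt.union {α : Type*} {S T : Set α} {B C : ℝ} (h : Cnt S B) (h' : Cnt T C) :
    Cnt (S ∪ T) (B + C) := by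
  classical
  obtain ⟨s, h1, h2⟩ := h
  obtain ⟨t, h3, h4⟩ := h'
  refine ⟨s ∪ t, ?_, ?_⟩
  · rw [Finset.coe_union]; exact Set.union_subset_union h1 h3
  · have : ((s ∪ t).card : ℝ) ≤ s.card + t.card := by exact_mod_cast Finset.card_union_le s t
    linarith

theorem Cnt.bind {α β : Type*} {S : Set α} {U : Set β} {B C : ℝ} (P : α → Set β)
    (h : Cnt S B) (hP : ∀ x ∈ S, Cnt (P x) C) (hC : 0 ≤ C)
    (hU : ∀ u ∈ U, ∃ x ∈ S, u ∈ P x) : Cnt U (B * C) := by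
  classical
  obtain ⟨s, h1, h2⟩ := h
  choose! t ht1 ht2 using hP
  refine ⟨(s.filter (· ∈ S)).biUnion t, ?_, ?_⟩
  · intro u hu
    obtain ⟨x, hx, hux⟩ := hU u hu
    simp only [Finset.coe_biUnion, Set.mem_iUnion]
    exact ⟨x, by simpa using ⟨h1 hx, hx⟩, ht1 x hx hux⟩
  · calc (((s.filter (· ∈ S)).biUnion t).card : ℝ)
        ≤ ∑ x ∈ s.filter (· ∈ S), ((t x).card : ℝ) := by exact_mod_cast Finset.card_biUnion_le
      _ ≤ ∑ x ∈ s.filter (· ∈ S), C :=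
          Finset.sum_le_sum fun x hx => ht2 x (Finset.mem_filter.1 hx).2
      _ = (s.filter (· ∈ S)).card * C := by simp
      _ ≤ s.card * C := by
          gcongr
          exact Finset.filter_subset _ _
      _ ≤ B * C := by gcongr

theorem Cnt.ncard {α : Type*} {S : Set α} {B : ℝ} (h : Cnt S B) : (S.ncard : ℝ) ≤ B := by
  obtain ⟨s, h1, h2⟩ := h
  refine le_trans ?_ h2
  have := Set.ncard_le_ncard h1 s.finite_toSet
  rw [Set.ncard_coe_finset] at this
  exact_mod_cast this

theorem cnt_empty {α : Type*} {B : ℝ} (hB : 0 ≤ B) : Cnt (∅ : Set α) B :=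
  ⟨∅, by simp, by simpa using hB⟩

theorem cnt_singleton {α : Type*} (x : α) : Cnt ({x} : Set α) 1 :=
  ⟨{x}, by simp, by simp⟩

theorem cnt_int {A X R : ℝ} (hA : 0 < A) (hR : 0 ≤ R) :
    Cnt {y : ℤ | |(y : ℝ) * A - X| ≤ R} (2 * R / A + 1) := by
  refine ⟨Finset.Icc ⌈(X - R) / A⌉ ⌊(X + R) / A⌋, ?_, ?_⟩
  · intro y hy
    simp only [Set.mem_ofPred_eq, abs_le] at hy
    simp only [Finset.coe_Icc, Set.mem_Icc, Int.ceil_le, Int.le_floor]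
    rw [div_le_iff₀ hA, le_div_iff₀ hA]
    constructor <;> linarith [hy.1, hy.2]
  · rw [Int.card_Icc]
    have h1 := Int.floor_le ((X + R) / A)
    have h2 := Int.le_ceil ((X - R) / A)
    have h3 : (X + R) / A - (X - R) / A = 2 * R / A := by field_simp; ring
    have h0 : 0 ≤ 2 * R / A := by positivity
    have : ((⌊(X + R) / A⌋ + 1 - ⌈(X - R) / A⌉).toNat : ℝ)
        = max ((⌊(X + R) / A⌋ : ℝ) + 1 - ⌈(X - R) / A⌉) 0 := by
      have := Int.toNat_eq_max (⌊(X + R) / A⌋ + 1 - ⌈(X - R) / A⌉)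
      have h := congrArg (Int.cast : ℤ → ℝ) this
      push_cast at h
      exact h
    rw [this]
    apply max_le <;> linarith

theorem cnt_nat_le {M : ℝ} (hM : 0 ≤ M) : Cnt {z : ℕ | 1 ≤ z ∧ (z : ℝ) ≤ M} M := by
  refine ⟨Finset.Icc 1 ⌊M⌋₊, ?_, ?_⟩
  · rintro z ⟨h1, h2⟩
    simpa using ⟨h1, Nat.le_floor h2⟩
  · simpa using Nat.floor_le hM

theorem cnt_near (L q : ℕ) : Cnt {z : ℕ | z < q ∧ q ≤ z + L} (L : ℝ) := by
  refine ⟨Finset.Ico (q - L) q, ?_, ?_⟩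
  · rintro z ⟨h1, h2⟩
    simp only [Finset.coe_Ico, Set.mem_Ico]
    omega
  · rw [Nat.card_Ico]
    exact_mod_cast (by omega : q - (q - L) ≤ L)

theorem cnt_spread {T : Set ℕ} {D : ℝ} (hD : 0 ≤ D)
    (h : ∀ z ∈ T, ∀ w ∈ T, z ≤ w → (w : ℝ) - z ≤ D) : Cnt T (D + 1) := by
  rcases T.eq_empty_or_nonempty with rfl | hne
  · exact cnt_empty (by linarith)
  · refine ⟨Finset.Icc (sInf T) (sInf T + ⌊D⌋₊), ?_, ?_⟩
    · intro w hw
      have h1 := Nat.sInf_le hw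
      have h2 := h _ (Nat.sInf_mem hne) w hw h1
      simp only [Finset.coe_Icc, Set.mem_Icc]
      refine ⟨h1, ?_⟩
      have : w - sInf T ≤ ⌊D⌋₊ := by
        apply Nat.le_floor
        rw [Nat.cast_sub h1]; exact h2
      omega
    · have := Nat.floor_le hD
      rw [Nat.card_Icc]
      have e : sInf T + ⌊D⌋₊ + 1 - sInf T = ⌊D⌋₊ + 1 := by omega
      rw [e]; push_cast; linarith

theorem cnt_pair {Z : Set ℕ} {Y : ℕ → Set ℤ} {B C : ℝ} (hZ : Cnt Z B)
    (hY : ∀ z ∈ Z, Cnt (Y z) C) (hC : 0 ≤ C) :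
    Cnt {p : ℤ × ℕ | p.2 ∈ Z ∧ p.1 ∈ Y p.2} (B * C) := by
  have := Cnt.bind (U := {p : ℤ × ℕ | p.2 ∈ Z ∧ p.1 ∈ Y p.2})
    (fun z => {p : ℤ × ℕ | p.2 = z ∧ p.1 ∈ Y z}) hZ (C := C) ?_ hC ?_
  · exact this
  · intro z hz
    have := Cnt.bind (U := {p : ℤ × ℕ | p.2 = z ∧ p.1 ∈ Y z}) (fun y => {(y, z)}) (hY z hz)
      (fun _ _ => cnt_singleton _) zero_le_one ?_
    · simpa using this
    · rintro ⟨y, w⟩ ⟨h1, h2⟩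
      simp only at h1 h2
      exact ⟨y, h2, by simp [h1]⟩
  · rintro ⟨y, z⟩ ⟨h1, h2⟩
    exact ⟨z, h1, rfl, h2⟩

theorem cnt_cons {α : Type*} {T : Set (List α)} {P : List α → Set α} {B C : ℝ} (hT : Cnt T B)
    (hP : ∀ l ∈ T, Cnt (P l) C) (hC : 0 ≤ C) :
    Cnt {m : List α | ∃ p l, m = p :: l ∧ l ∈ T ∧ p ∈ P l} (B * C) := by
  refine Cnt.bind (fun l => {m : List α | ∃ p ∈ P l, m = p :: l}) hT ?_ hC ?_
  · intro l hl
    have := Cnt.bind (U := {m : List α | ∃ p ∈ P l, m = p :: l}) (fun p => {p :: l}) (hP l hl)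
      (fun _ _ => cnt_singleton _) zero_le_one ?_
    · simpa using this
    · rintro m ⟨p, hp, rfl⟩
      exact ⟨p, hp, rfl⟩
  · rintro m ⟨p, l, rfl, hl, hp⟩
    exact ⟨l, hl, p, hp, rfl⟩

noncomputable def sumA (a : ℕ → ℝ) (l : List (ℤ × ℕ)) : ℝ :=
  (l.map fun p => (p.1 : ℝ) * a p.2).sum

def sumY (l : List (ℤ × ℕ)) : ℤ := (l.map fun p => p.1).sum

def Bd (M : ℝ) (p : ℤ × ℕ) : Prop := |(p.1 : ℝ)| ≤ M ∧ 1 ≤ p.2 ∧ (p.2 : ℝ) ≤ M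

def Clo (a : ℕ → ℝ) (K : ℝ) : List (ℤ × ℕ) → Prop
  | [] => True
  | q :: l => |sumA a (q :: l)| ≤ K + a q.2

def Near (L : ℕ) (z : ℕ) : List (ℤ × ℕ) → Prop
  | [] => False
  | q :: _ => z < q.2 ∧ q.2 ≤ z + L

def Feas (a : ℕ → ℝ) (K M : ℝ) (L : ℕ) : List (ℤ × ℕ) → Prop
  | [] => True
  | p :: l => Bd M p ∧ Feas a K M L l ∧ (Clo a K l ∨ Near L p.2 l)

@[simp] theorem sumA_cons (a : ℕ → ℝ) (p l) : sumA a (p :: l) = p.1 * a p.2 + sumA a l := by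
  simp [sumA]
@[simp] theorem sumY_cons (p l) : sumY (p :: l) = p.1 + sumY l := by
  simp [sumY]
@[simp] theorem sumA_nil (a : ℕ → ℝ) : sumA a [] = 0 := by simp [sumA]
@[simp] theorem sumY_nil : sumY [] = 0 := by simp [sumY]

def FS (a : ℕ → ℝ) (K M : ℝ) (L k : ℕ) : Set (List (ℤ × ℕ)) :=
  {l | l.length = k ∧ Feas a K M L l}

def QS (a : ℕ → ℝ) (K M : ℝ) (L k : ℕ) : Set (List (ℤ × ℕ)) :=
  {l | l.length = k ∧ Feas a K M L l ∧ Clo a K l}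

/-- growth of the sequence -/
theorem lac_diff {c : ℝ} (hc : 1 < c) {a : ℕ → ℝ} (hpos : ∀ n ≥ 1, 0 < a n)
    (hlac : ∀ n ≥ 1, c * a n ≤ a (n + 1)) :
    (∀ n ≥ 1, a 1 ≤ a n) ∧ (∀ n ≥ 1, ∀ k : ℕ, a n + k * ((c - 1) * a 1) ≤ a (n + k)) ∧
    (∀ n ≥ 1, ∀ k : ℕ, c ^ k * a n ≤ a (n + k)) := by
  have h1 : ∀ n ≥ 1, a 1 ≤ a n := by
    intro n hn
    induction n, hn using Nat.le_induction with
    | base => exact le_rfl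
    | succ n hn ih => nlinarith [hlac n hn, hpos n hn]
  refine ⟨h1, ?_, ?_⟩
  · intro n hn k
    induction k with
    | zero => simp
    | succ k ih =>
      have := hlac (n + k) (by omega)
      have h2 := h1 (n + k) (by omega)
      rw [← add_assoc]
      push_cast
      nlinarith
  · intro n hn k
    induction k with
    | zero => simp
    | succ k ih =>
      have := hlac (n + k) (by omega)
      rw [← add_assoc, pow_succ]
      nlinarith

theorem cnt_y {M : ℝ} (hM : 1 ≤ M) : Cnt {y : ℤ | |(y : ℝ)| ≤ M} (3 * M) := by
  refine (cnt_int (A := 1) (X := 0) (R := M) one_pos (by linarith)).mono ?_ (by linarith)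
  intro y hy
  simpa using hy

theorem main_FQ {a : ℕ → ℝ} {a1 : ℝ} (ha1 : 0 < a1) (hge : ∀ n ≥ 1, a1 ≤ a n)
    {K M : ℝ} (hK : 1 ≤ K) (hM : 1 ≤ M) (L : ℕ) {Λ C C1 : ℝ} (hΛ : 1 ≤ Λ) (hL : (L : ℝ) ≤ Λ)
    (hC1 : C1 = 3 + 2 / a1) (hC6 : 6 ≤ C) (hCC1 : 2 * C1 ≤ C) (k : ℕ) :
    Cnt (FS a K M L k) (C ^ k * K ^ k * M ^ (k + 1) * Λ ^ k) ∧
    Cnt (QS a K M L k) (C ^ k * K ^ k * M ^ k * Λ ^ k) := by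
  have hC1pos : 0 < C1 := by rw [hC1]; positivity
  have hM0 : 0 ≤ M := by linarith
  induction k with
  | zero =>
    have h : Cnt (FS a K M L 0) 1 := by
      refine (cnt_singleton []).mono ?_ le_rfl
      rintro l ⟨h, -⟩
      simpa using h
    refine ⟨h.mono le_rfl (by simpa using hM), h.mono ?_ (by simp)⟩
    rintro l ⟨h, h', -⟩
    exact ⟨h, h'⟩
  | succ k ih =>
    obtain ⟨hF, hQ⟩ := ih
    set E := C ^ k * K ^ k * M ^ k * Λ ^ k with hE
    have hE0 : 0 ≤ E := by positivity
    have hF' : Cnt (FS a K M L k) (E * M) := hF.mono le_rfl (by rw [hE, pow_succ]; apply le_of_eq; ring)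
    have hnear : ∀ l : List (ℤ × ℕ), Cnt {z : ℕ | Near L z l} Λ := by
      intro l
      cases l with
      | nil => exact (cnt_empty (by linarith)).mono (fun z hz => hz.elim) le_rfl
      | cons q l => exact (cnt_near L q.2).mono (fun z hz => hz) hL
    have hwin : ∀ (S : ℝ) (z : ℕ), 1 ≤ z →
        Cnt {y : ℤ | |(y : ℝ) * a z + S| ≤ K + a z} (C1 * K) := by
      intro S z hz
      have haz := hge z hz
      have haz0 : 0 < a z := by linarith
      refine (cnt_int (A := a z) (X := -S) (R := K + a z) haz0 (by linarith)).mono ?_ ?_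
      · intro y hy; simpa using hy
      · have : 2 * (K + a z) / a z = 2 * K / a z + 2 := by field_simp
        have h2 : 2 * K / a z ≤ 2 * K / a1 := by gcongr
        have h3 : (3 + 2 / a1) * K = 3 * K + 2 * K / a1 := by ring
        rw [hC1, h3, this]; linarith
    constructor
    · have A1 := cnt_cons (P := fun _ => {p : ℤ × ℕ | p.2 ∈ {z : ℕ | 1 ≤ z ∧ (z : ℝ) ≤ M} ∧
          p.1 ∈ {y : ℤ | |(y : ℝ)| ≤ M}}) hQ
          (fun _ _ => cnt_pair (cnt_nat_le hM0) (fun _ _ => cnt_y hM) (by positivity))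
          (by positivity)
      have A2 := cnt_cons (P := fun l => {p : ℤ × ℕ | p.2 ∈ {z : ℕ | Near L z l} ∧
          p.1 ∈ {y : ℤ | |(y : ℝ)| ≤ M}}) hF'
          (fun l _ => cnt_pair (hnear l) (fun _ _ => cnt_y hM) (by positivity))
          (by positivity)
      refine (A1.union A2).mono ?_ ?_
      · rintro l ⟨hl, hf⟩
        cases l with
        | nil => simp at hl
        | cons p l =>
          obtain ⟨hb, hf, hcn⟩ := hf
          have hl' : l.length = k := by simpa using hl
          rcases hcn with h | h
          · exact Or.inl ⟨p, l, rfl, ⟨hl', hf, h⟩, hb.2, hb.1⟩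
          · exact Or.inr ⟨p, l, rfl, ⟨hl', hf⟩, h, hb.1⟩
      · have e : C ^ (k + 1) * K ^ (k + 1) * M ^ (k + 1 + 1) * Λ ^ (k + 1)
            = (E * M ^ 2) * (C * K * Λ) := by rw [hE]; ring
        have e2 : E * (M * (3 * M)) + E * M * (Λ * (3 * M)) = (E * M ^ 2) * (3 + 3 * Λ) := by ring
        rw [e, e2]
        gcongr
        calc 3 + 3 * Λ ≤ 6 * 1 * Λ := by linarith
          _ ≤ C * K * Λ := by gcongr
    · have A1 := cnt_cons (P := fun l => {p : ℤ × ℕ | p.2 ∈ {z : ℕ | 1 ≤ z ∧ (z : ℝ) ≤ M} ∧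
          p.1 ∈ {y : ℤ | |(y : ℝ) * a p.2 + sumA a l| ≤ K + a p.2}}) hQ
          (fun l _ => cnt_pair (Y := fun z => {y : ℤ | |(y : ℝ) * a z + sumA a l| ≤ K + a z})
            (cnt_nat_le hM0) (fun z hz => hwin _ z hz.1) (by positivity))
          (by positivity)
      have A2 := cnt_cons (P := fun l => {p : ℤ × ℕ | p.2 ∈ {z : ℕ | Near L z l ∧ 1 ≤ z} ∧
          p.1 ∈ {y : ℤ | |(y : ℝ) * a p.2 + sumA a l| ≤ K + a p.2}}) hF'
          (fun l _ => cnt_pair (Y := fun z => {y : ℤ | |(y : ℝ) * a z + sumA a l| ≤ K + a z})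
            ((hnear l).mono (fun z hz => hz.1) le_rfl) (fun z hz => hwin _ z hz.2) (by positivity))
          (by positivity)
      refine (A1.union A2).mono ?_ ?_
      · rintro l ⟨hl, hf, hclo⟩
        cases l with
        | nil => simp at hl
        | cons p l =>
          obtain ⟨hb, hf, hcn⟩ := hf
          have hl' : l.length = k := by simpa using hl
          have hclo' : |(p.1 : ℝ) * a p.2 + sumA a l| ≤ K + a p.2 := by
            simpa [Clo] using hclo
          rcases hcn with h | h
          · exact Or.inl ⟨p, l, rfl, ⟨hl', hf, h⟩, hb.2, hclo'⟩
          · exact Or.inr ⟨p, l, rfl, ⟨hl', hf⟩, ⟨h, hb.2.1⟩, hclo'⟩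
      · have e : C ^ (k + 1) * K ^ (k + 1) * M ^ (k + 1) * Λ ^ (k + 1)
            = (E * M * K) * (C * Λ) := by rw [hE]; ring
        have e2 : E * (M * (C1 * K)) + E * M * (Λ * (C1 * K)) = (E * M * K) * (C1 + C1 * Λ) := by
          ring
        rw [e, e2]
        gcongr
        calc C1 + C1 * Λ ≤ 2 * C1 * Λ := by nlinarith
          _ ≤ C * Λ := by gcongr

/-- the lists that come from solutions -/
def NS (a : ℕ → ℝ) (K M : ℝ) (L k : ℕ) : Set (List (ℤ × ℕ)) :=
  {l | l.length = k ∧ Feas a K M L l ∧ |sumA a l| ≤ K ∧ sumY l = 0 ∧ ∃ p ∈ l, p.1 ≠ 0}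

theorem main_N {a : ℕ → ℝ} {a1 c : ℝ} (hc : 1 < c) (ha1 : 0 < a1) (hge : ∀ n ≥ 1, a1 ≤ a n)
    (hdiff : ∀ n ≥ 1, ∀ k : ℕ, a n + k * ((c - 1) * a1) ≤ a (n + k))
    {K M : ℝ} (hK : 1 ≤ K) (hM : 1 ≤ M) (L : ℕ) {Λ C C1 C2 : ℝ} (hΛ : 1 ≤ Λ) (hL : (L : ℝ) ≤ Λ)
    (hC1 : C1 = 3 + 2 / a1) (hC6 : 6 ≤ C) (hCC1 : 2 * C1 ≤ C)
    (hC2 : C2 = 2 / ((c - 1) * a1) + 1) (hCC2 : 3 * C2 ≤ C) (k : ℕ) :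
    Cnt (NS a K M L (k + 1)) ((k + 1) * (C ^ (k + 1) * K ^ (k + 1) * M ^ k * Λ ^ (k + 1))) := by
  have hδ : 0 < (c - 1) * a1 := mul_pos (by linarith) ha1
  have hC2pos : 0 < C2 := by rw [hC2]; positivity
  have hM0 : 0 ≤ M := by linarith
  have hC2K : 2 * K / ((c - 1) * a1) + 1 ≤ C2 * K := by
    have : C2 * K = 2 * K / ((c - 1) * a1) + K := by rw [hC2]; ring
    linarith
  have hFQ := main_FQ ha1 hge hK hM L hΛ hL hC1 hC6 hCC1
  -- nonzero head
  have big : ∀ k, Cnt {m : List (ℤ × ℕ) | ∃ p l, m = p :: l ∧ l ∈ QS a K M L k ∧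
      p ∈ {p : ℤ × ℕ | p.1 = - sumY l ∧ p.1 ≠ 0 ∧ 1 ≤ p.2 ∧ |(p.1 : ℝ) * a p.2 + sumA a l| ≤ K}}
      (C ^ k * K ^ k * M ^ k * Λ ^ k * (C2 * K)) := by
    intro k
    refine cnt_cons (P := fun l => {p : ℤ × ℕ | p.1 = - sumY l ∧ p.1 ≠ 0 ∧ 1 ≤ p.2 ∧
      |(p.1 : ℝ) * a p.2 + sumA a l| ≤ K}) (hFQ k).2 ?_ (by positivity)
    intro l hl
    have h1 : Cnt {z : ℕ | - sumY l ≠ 0 ∧ 1 ≤ z ∧ |((- sumY l : ℤ) : ℝ) * a z + sumA a l| ≤ K}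
        (C2 * K) := by
      refine (cnt_spread (D := 2 * K / ((c - 1) * a1)) (by positivity) ?_).mono le_rfl hC2K
      rintro z ⟨h0, hz1, hz⟩ w ⟨-, hw1, hw⟩ hzw
      obtain ⟨d, rfl⟩ := Nat.exists_eq_add_of_le hzw
      have hd := hdiff z hz1 d
      have h0' : (1 : ℝ) ≤ |((- sumY l : ℤ) : ℝ)| := by
        exact_mod_cast Int.one_le_abs h0
      set Y := ((- sumY l : ℤ) : ℝ)
      have h2 : |Y * (a (z + d) - a z)| ≤ 2 * K := by
        rw [abs_le] at hz hw ⊢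
        constructor <;> nlinarith [hz.1, hz.2, hw.1, hw.2]
      rw [abs_mul] at h2
      have h3 : (d : ℝ) * ((c - 1) * a1) ≤ |a (z + d) - a z| :=
        le_trans (by linarith) (le_abs_self _)
      have h4 : |a (z + d) - a z| ≤ 2 * K := by
        nlinarith [abs_nonneg (a (z + d) - a z)]
      rw [le_div_iff₀ hδ]
      push_cast
      linarith
    refine ((cnt_pair (Y := fun _ => {- sumY l}) h1 (fun _ _ => cnt_singleton _)
      zero_le_one).mono ?_ (by simp))
    rintro ⟨y, z⟩ ⟨h1, h2, h3, h4⟩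
    simp only at h1 h2 h3 h4
    subst h1
    exact ⟨⟨h2, h3, h4⟩, rfl⟩
  have hnear : ∀ l : List (ℤ × ℕ), Cnt {z : ℕ | Near L z l} Λ := by
    intro l
    cases l with
    | nil => exact (cnt_empty (by linarith)).mono (fun z hz => hz.elim) le_rfl
    | cons q l => exact (cnt_near L q.2).mono (fun z hz => hz) hL
  -- near head: lists p :: q :: l
  have fin2 : ∀ l : List (ℤ × ℕ), ∀ w z : ℕ, 1 ≤ z → z < w →
      Cnt {m : List (ℤ × ℕ) | ∃ y x : ℤ, m = (x, z) :: (y, w) :: l ∧ |sumA a m| ≤ K ∧ sumY m = 0}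
        (C2 * K) := by
    intro l w z hz hzw
    obtain ⟨d, rfl⟩ := Nat.exists_eq_add_of_le hzw.le
    have hd := hdiff z hz d
    have hd1 : (1 : ℝ) ≤ d := by exact_mod_cast (by omega : 1 ≤ d)
    have hA : (c - 1) * a1 ≤ a (z + d) - a z := by nlinarith
    have h1 := cnt_int (A := a (z + d) - a z) (X := sumY l * a z - sumA a l) (R := K)
      (by linarith) (by linarith)
    have h2 : 2 * K / (a (z + d) - a z) + 1 ≤ C2 * K := by
      refine le_trans ?_ hC2K
      gcongr
    have := Cnt.bind (U := {m : List (ℤ × ℕ) | ∃ y x : ℤ, m = (x, z) :: (y, z + d) :: l ∧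
        |sumA a m| ≤ K ∧ sumY m = 0}) (fun y => {(-(y + sumY l), z) :: (y, z + d) :: l})
        (h1.mono le_rfl h2) (fun _ _ => cnt_singleton _) zero_le_one ?_
    · simpa using this
    · rintro m ⟨y, x, rfl, hA, hY⟩
      simp only [sumY_cons] at hY
      have hx : x = -(y + sumY l) := by omega
      refine ⟨y, ?_, by simp [hx]⟩
      simp only [sumA_cons] at hA
      simp only [Set.mem_ofPred_eq]
      convert hA using 2
      rw [hx]; push_cast; ring
  have fin1 : ∀ l : List (ℤ × ℕ), ∀ w : ℕ,
      Cnt {m : List (ℤ × ℕ) | ∃ z : ℕ, ∃ y x : ℤ, (1 ≤ z ∧ z < w ∧ w ≤ z + L) ∧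
        m = (x, z) :: (y, w) :: l ∧ |sumA a m| ≤ K ∧ sumY m = 0} (Λ * (C2 * K)) := by
    intro l w
    refine Cnt.bind (S := {z : ℕ | 1 ≤ z ∧ z < w ∧ w ≤ z + L}) (fun z => {m : List (ℤ × ℕ) | ∃ y x : ℤ, m = (x, z) :: (y, w) :: l ∧ |sumA a m| ≤ K ∧ sumY m = 0}) ((cnt_near L w).mono (fun z hz => hz.2) hL) ?_ (by positivity) ?_
    · intro z hz
      exact fin2 l w z hz.1 hz.2.1
    · rintro m ⟨z, y, x, h1, h2⟩
      exact ⟨z, h1, y, x, h2⟩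
  have near : ∀ k, Cnt {m : List (ℤ × ℕ) | ∃ p q l, m = p :: q :: l ∧ l.length = k ∧
      Feas a K M L m ∧ Near L p.2 (q :: l) ∧ |sumA a m| ≤ K ∧ sumY m = 0}
      ((C ^ k * K ^ k * M ^ k * Λ ^ k) * (M * (Λ * (C2 * K))) +
       (C ^ k * K ^ k * M ^ (k + 1) * Λ ^ k) * (Λ * (Λ * (C2 * K)))) := by
    intro k
    have B : ∀ (l : List (ℤ × ℕ)) (W : Set ℕ) (B : ℝ), Cnt W B →
        Cnt {m : List (ℤ × ℕ) | ∃ w ∈ W, ∃ z : ℕ, ∃ y x : ℤ, (1 ≤ z ∧ z < w ∧ w ≤ z + L) ∧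
        m = (x, z) :: (y, w) :: l ∧ |sumA a m| ≤ K ∧ sumY m = 0} (B * (Λ * (C2 * K))) := by
      intro l W B hW
      refine Cnt.bind (fun w => {m : List (ℤ × ℕ) | ∃ z : ℕ, ∃ y x : ℤ, (1 ≤ z ∧ z < w ∧ w ≤ z + L) ∧
        m = (x, z) :: (y, w) :: l ∧ |sumA a m| ≤ K ∧ sumY m = 0}) hW (fun w _ => fin1 l w)
        (by positivity) ?_
      rintro m ⟨w, hw, h⟩
      exact ⟨w, hw, h⟩
    have A1 := Cnt.bind (U := {m : List (ℤ × ℕ) | ∃ l ∈ QS a K M L k, ∃ w ∈ {z : ℕ | 1 ≤ z ∧ (z : ℝ) ≤ M}, ∃ z : ℕ, ∃ y x : ℤ, (1 ≤ z ∧ z < w ∧ w ≤ z + L) ∧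
        m = (x, z) :: (y, w) :: l ∧ |sumA a m| ≤ K ∧ sumY m = 0}) _ (hFQ k).2
        (fun l _ => B l _ _ (cnt_nat_le hM0)) (by positivity) (fun u hu => hu)
    have A2 := Cnt.bind (U := {m : List (ℤ × ℕ) | ∃ l ∈ FS a K M L k, ∃ w ∈ {z : ℕ | Near L z l}, ∃ z : ℕ, ∃ y x : ℤ, (1 ≤ z ∧ z < w ∧ w ≤ z + L) ∧
        m = (x, z) :: (y, w) :: l ∧ |sumA a m| ≤ K ∧ sumY m = 0}) _ (hFQ k).1
        (fun l _ => B l _ _ (hnear l)) (by positivity) (fun u hu => hu)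
    refine (A1.union A2).mono ?_ le_rfl
    rintro m ⟨⟨x, z⟩, ⟨y, w⟩, l, rfl, hl, ⟨hb, ⟨hb', hf, hcn⟩, -⟩, hn, hA, hY⟩
    rcases hcn with h | h
    · exact Or.inl ⟨l, ⟨hl, hf, h⟩, w, hb'.2, z, y, x, ⟨hb.2.1, hn⟩, rfl, hA, hY⟩
    · exact Or.inr ⟨l, ⟨hl, hf⟩, w, h, z, y, x, ⟨hb.2.1, hn⟩, rfl, hA, hY⟩
  -- decomposition
  have bigbd : ∀ k, (C ^ k * K ^ k * M ^ k * Λ ^ k * (C2 * K)) ≤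
      C2 * (C ^ k * K ^ (k + 1) * M ^ k * Λ ^ (k + 1)) := by
    intro k
    have e : C ^ k * K ^ k * M ^ k * Λ ^ k * (C2 * K)
      = C2 * (C ^ k * K ^ (k + 1) * M ^ k * Λ ^ k) := by ring
    rw [e]
    gcongr
    omega
  have stuff : ∀ k, Cnt {m | m ∈ NS a K M L (k + 1) ∧ ∀ p ∈ m.head?, p.1 ≠ 0}
      (C ^ (k + 1) * K ^ (k + 1) * M ^ k * Λ ^ (k + 1)) := by
    intro k
    have hsplit : ∀ m ∈ {m | m ∈ NS a K M L (k + 1) ∧ ∀ p ∈ m.head?, p.1 ≠ 0},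
        m ∈ {m : List (ℤ × ℕ) | ∃ p l, m = p :: l ∧ l ∈ QS a K M L k ∧
      p ∈ {p : ℤ × ℕ | p.1 = - sumY l ∧ p.1 ≠ 0 ∧ 1 ≤ p.2 ∧ |(p.1 : ℝ) * a p.2 + sumA a l| ≤ K}} ∨
        ∃ p q l, m = p :: q :: l ∧ l.length + 1 = k ∧
      Feas a K M L m ∧ Near L p.2 (q :: l) ∧ |sumA a m| ≤ K ∧ sumY m = 0 := by
      rintro m ⟨⟨hl, hf, hA, hY, -⟩, hh⟩
      cases m with
      | nil => simp at hl
      | cons p l =>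
        have hl' : l.length = k := by simpa using hl
        have hp : p.1 ≠ 0 := hh p (by simp)
        have hf' := hf
        obtain ⟨hb, hf1, hcn⟩ := hf'
        rcases hcn with h | h
        · left
          refine ⟨p, l, rfl, ⟨hl', hf1, h⟩, ?_, hp, hb.2.1, by simpa using hA⟩
          simp only [sumY_cons] at hY
          omega
        · right
          cases l with
          | nil => exact h.elim
          | cons q l => exact ⟨p, q, l, rfl, by simpa using hl', hf, h, hA, hY⟩
    cases k with
    | zero =>
      refine (big 0).mono ?_ ?_
      · intro m hm
        rcases hsplit m hm with h | ⟨p, q, l, -, h, -⟩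
        · exact h
        · omega
      · refine (bigbd 0).trans ?_
        have : C2 ≤ C := by linarith
        rw [pow_succ C]
        calc C2 * (C ^ 0 * K ^ (0 + 1) * M ^ 0 * Λ ^ (0 + 1)) ≤
            C * (C ^ 0 * K ^ (0 + 1) * M ^ 0 * Λ ^ (0 + 1)) := by gcongr
          _ = _ := by ring
    | succ k =>
      refine ((big (k + 1)).union (near k)).mono ?_ ?_
      · intro m hm
        rcases hsplit m hm with h | ⟨p, q, l, h1, h2, h3⟩
        · exact Or.inl h
        · exact Or.inr ⟨p, q, l, h1, by omega, h3⟩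
      · have h1 := bigbd (k + 1)
        set G := C ^ k * K ^ (k + 1) * M ^ (k + 1) * Λ ^ (k + 1) with hG
        have hG0 : 0 ≤ G := by positivity
        have e1 : C2 * (C ^ (k + 1) * K ^ (k + 1 + 1) * M ^ (k + 1) * Λ ^ (k + 1 + 1))
            = C2 * G * (C * K * Λ) := by rw [hG]; ring
        have e2 : C ^ k * K ^ k * M ^ k * Λ ^ k * (M * (Λ * (C2 * K))) +
            C ^ k * K ^ k * M ^ (k + 1) * Λ ^ k * (Λ * (Λ * (C2 * K))) = C2 * G * (1 + Λ) := by
          rw [hG]; ring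
        have e3 : C ^ (k + 1 + 1) * K ^ (k + 1 + 1) * M ^ (k + 1) * Λ ^ (k + 1 + 1)
            = C * G * (C * K * Λ) := by rw [hG]; ring
        rw [e1] at h1
        rw [e2, e3]
        have h4 : 1 + Λ ≤ 2 * (C * K * Λ) := by
          have : 1 * 1 * Λ ≤ C * K * Λ := by gcongr; linarith
          linarith
        calc _ ≤ C2 * G * (C * K * Λ) + C2 * G * (2 * (C * K * Λ)) := by gcongr
          _ = 3 * C2 * G * (C * K * Λ) := by ring
          _ ≤ C * G * (C * K * Λ) := by gcongr
  have zero : ∀ k, ∀ m ∈ NS a K M L (k + 1), ¬ (∀ p ∈ m.head?, p.1 ≠ 0) →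
      m ∈ {m : List (ℤ × ℕ) | ∃ p l, m = p :: l ∧ l ∈ NS a K M L k ∧
        p ∈ {p : ℤ × ℕ | p.2 ∈ {z : ℕ | 1 ≤ z ∧ (z : ℝ) ≤ M} ∧ p.1 ∈ ({0} : Set ℤ)}} := by
    rintro k m ⟨hl, hf, hA, hY, hne⟩ hh
    cases m with
    | nil => simp at hl
    | cons p l =>
      have hp : p.1 = 0 := by simpa using hh
      obtain ⟨hb, hf1, -⟩ := hf
      refine ⟨p, l, rfl, ⟨by simpa using hl, hf1, by simpa [hp] using hA,
        by simpa [hp] using hY, ?_⟩, hb.2, hp⟩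
      simpa [hp] using hne
  induction k with
  | zero =>
    refine (stuff 0).mono ?_ (by simp)
    intro m hm
    refine ⟨hm, ?_⟩
    by_contra hcon
    obtain ⟨p, l, -, ⟨hl, -, -, -, q, hq, -⟩, -⟩ := zero 0 m hm hcon
    have : l = [] := by simpa using hl
    simp [this] at hq
  | succ k ih =>
    have A := cnt_cons (P := fun _ => {p : ℤ × ℕ | p.2 ∈ {z : ℕ | 1 ≤ z ∧ (z : ℝ) ≤ M} ∧
      p.1 ∈ ({0} : Set ℤ)}) ih (fun _ _ => cnt_pair (Y := fun _ => {0}) (cnt_nat_le hM0)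
        (fun _ _ => cnt_singleton _) zero_le_one) (by positivity)
    refine ((stuff (k + 1)).union A).mono ?_ ?_
    · intro m hm
      by_cases h : ∀ p ∈ m.head?, p.1 ≠ 0
      · exact Or.inl ⟨hm, h⟩
      · exact Or.inr (zero _ m hm h)
    · set G := C ^ (k + 1) * K ^ (k + 1) * M ^ (k + 1) * Λ ^ (k + 1) with hG
      have hG0 : 0 ≤ G := by positivity
      have e1 : C ^ (k + 1 + 1) * K ^ (k + 1 + 1) * M ^ (k + 1) * Λ ^ (k + 1 + 1)
          = G * (C * K * Λ) := by rw [hG]; ring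
      have e2 : (↑k + 1) * (C ^ (k + 1) * K ^ (k + 1) * M ^ k * Λ ^ (k + 1)) * (M * 1)
          = (↑k + 1) * G := by rw [hG]; ring
      rw [e1, e2]
      have h4 : 1 ≤ C * K * Λ := by
        have : 1 * 1 * 1 ≤ C * K * Λ := by gcongr; linarith
        linarith
      have : G ≤ G * (C * K * Λ) := le_mul_of_one_le_right hG0 h4
      push_cast
      nlinarith

/-- solutions, sorted, are feasible -/
theorem feas_of {a : ℕ → ℝ} {c K M : ℝ} (hpos : ∀ n ≥ 1, 0 < a n)
    (hpow : ∀ n ≥ 1, ∀ k : ℕ, c ^ k * a n ≤ a (n + k)) (hc : 1 < c)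
    (hM : 1 ≤ M) (L r : ℕ) (hr : 1 ≤ r) (hL : r * M ≤ c ^ L) (l : List (ℤ × ℕ)) :
    ∀ (j : ℕ) (b : ℝ), (∀ p ∈ l, Bd M p) → l.Pairwise (fun p q => p.2 < q.2) →
      j + l.length ≤ r → (∀ p ∈ l, b ≤ a p.2) → |sumA a l| ≤ K + j * M * b → Feas a K M L l := by
  have hmono : ∀ n ≥ 1, ∀ m ≥ n, a n ≤ a m := by
    intro n hn m hm
    obtain ⟨d, rfl⟩ := Nat.exists_eq_add_of_le hm
    have h1 := hpow n hn d
    have h2 : 1 ≤ c ^ d := one_le_pow₀ hc.le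
    nlinarith [hpos n hn]
  induction l with
  | nil => intros; trivial
  | cons p l ih =>
    intro j b hb hpw hj hba hA
    have hbp := hb p (by simp)
    rw [List.pairwise_cons] at hpw
    have hbd := hba p (by simp)
    have hap := hpos p.2 hbp.2.1
    have key : |sumA a l| ≤ K + ((j + 1 : ℕ) : ℝ) * M * a p.2 := by
      rw [sumA_cons] at hA
      have h1 : |(p.1 : ℝ) * a p.2| ≤ M * a p.2 := by
        rw [abs_mul, abs_of_pos hap]
        exact mul_le_mul_of_nonneg_right hbp.1 hap.le
      have h2 : (j : ℝ) * M * b ≤ j * M * a p.2 := by gcongr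
      rw [abs_le] at *
      push_cast
      constructor <;> nlinarith [hA.1, hA.2, h1.1, h1.2]
    refine ⟨hbp, ih (j + 1) (a p.2) (fun q hq => hb q (by simp [hq])) hpw.2
      (by simp at hj; omega) ?_ key, ?_⟩
    · intro q hq
      exact hmono _ hbp.2.1 _ (hpw.1 q hq).le
    · cases l with
      | nil => exact Or.inl trivial
      | cons q l =>
        have hpq := hpw.1 q (by simp)
        by_cases hn : q.2 ≤ p.2 + L
        · exact Or.inr ⟨hpq, hn⟩
        · left
          simp only [Clo]
          refine key.trans ?_
          have h1 := hpow p.2 hbp.2.1 L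
          have h2 := hmono (p.2 + L) (by have := hbp.2.1; omega) q.2 (by omega)
          have h3 : ((j + 1 : ℕ) : ℝ) ≤ r := by
            simp at hj
            exact_mod_cast (by omega : j + 1 ≤ r)
          have h4 : ((j + 1 : ℕ) : ℝ) * M * a p.2 ≤ r * M * a p.2 := by gcongr
          have h5 : (r : ℝ) * M * a p.2 ≤ c ^ L * a p.2 := by gcongr
          linarith


theorem stmt4 (c : ℝ) (hc : 1 < c) (r : ℕ) (hr : 1 ≤ r) (ε : ℝ) (hε : 0 < ε)
    (a1 : ℝ) (ha1 : 0 < a1) :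
    ∃ K0 : ℝ, 0 < K0 ∧ ∀ a : ℕ → ℝ, a 1 = a1 → (∀ n ≥ 1, 0 < a n) →
      (∀ n ≥ 1, c * a n ≤ a (n + 1)) →
      ∀ M K : ℝ, 1 ≤ M → 1 ≤ K →
      ({p : (Fin r → ℤ) × (Fin r → ℕ) |
          (∀ i, |(p.1 i : ℝ)| ≤ M) ∧
          (∀ i, 1 ≤ p.2 i ∧ (p.2 i : ℝ) ≤ M) ∧
          Function.Injective p.2 ∧
          p.1 ≠ 0 ∧
          |∑ i, (p.1 i : ℝ) * a (p.2 i)| ≤ K ∧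
          ∑ i, p.1 i = 0}.ncard : ℝ) ≤
        K0 * K ^ r * M ^ ((r : ℝ) - 1 + ε) := by
  classical
  have hlc : 0 < Real.log c := Real.log_pos hc
  obtain ⟨k, rfl⟩ : ∃ k, r = k + 1 := ⟨r - 1, by omega⟩
  set r := k + 1 with hrk
  have hr0 : (0 : ℝ) < r := by positivity
  set η : ℝ := ε / r with hη
  have hη0 : 0 < η := by positivity
  set C1 : ℝ := 3 + 2 / a1 with hC1
  set C2 : ℝ := 2 / ((c - 1) * a1) + 1 with hC2
  have hδ : 0 < (c - 1) * a1 := mul_pos (by linarith) ha1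
  have hC1p : 0 < C1 := by positivity
  have hC2p : 0 < C2 := by positivity
  set C : ℝ := 6 + 2 * C1 + 3 * C2 with hC
  have hlr : 0 ≤ Real.log r := Real.log_nonneg (by exact_mod_cast hr)
  set D : ℝ := Real.log r / Real.log c + 1 / (η * Real.log c) + 1 with hD
  have hD0 : 0 < D := by positivity
  refine ⟨(r.factorial : ℝ) * ((k + 1) * (C ^ r * D ^ r)), by positivity, ?_⟩
  intro a haa hpos hlac M K hM hK
  have hM0 : 0 < M := by linarith
  obtain ⟨hge, hdiff, hpow⟩ := lac_diff hc hpos hlac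
  rw [haa] at hge hdiff
  set L : ℕ := ⌈Real.log (r * M) / Real.log c⌉₊ with hLdef
  have hrM : 1 ≤ (r : ℝ) * M := by
    have : (1 : ℝ) ≤ r := by exact_mod_cast hr
    nlinarith
  have hL : (r : ℝ) * M ≤ c ^ L := by
    have h1 := Nat.le_ceil (Real.log (r * M) / Real.log c)
    rw [div_le_iff₀ hlc, ← Real.log_pow] at h1
    exact (Real.log_le_log_iff (by linarith) (by positivity)).1 h1
  set Λ : ℝ := D * M ^ η with hΛ
  have hMη : 1 ≤ M ^ η := Real.one_le_rpow hM hη0.le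
  have hΛ1 : 1 ≤ Λ := by
    have : 1 ≤ D := by
      have : 0 ≤ Real.log r / Real.log c + 1 / (η * Real.log c) := by positivity
      linarith
    nlinarith
  have hLΛ : (L : ℝ) ≤ Λ := by
    have h0 : 0 ≤ Real.log (r * M) / Real.log c := div_nonneg (Real.log_nonneg hrM) hlc.le
    have h1 := (Nat.ceil_lt_add_one h0).le
    refine h1.trans ?_
    rw [Real.log_mul hr0.ne' hM0.ne', add_div]
    have h2 : Real.log M / Real.log c ≤ 1 / (η * Real.log c) * M ^ η := by
      have := Real.log_le_rpow_div hM0.le hη0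
      calc Real.log M / Real.log c ≤ (M ^ η / η) / Real.log c := by gcongr
        _ = _ := by field_simp
    have h3 : Real.log r / Real.log c ≤ Real.log r / Real.log c * M ^ η :=
      le_mul_of_one_le_right (by positivity) hMη
    rw [hΛ, hD, add_mul, add_mul]
    linarith
  have hN := main_N hc ha1 hge hdiff hK hM L hΛ1 hLΛ hC1 (C := C) (by linarith) (by linarith) hC2
    (by linarith) k
  set S : Set ((Fin r → ℤ) × (Fin r → ℕ)) := {p | (∀ i, |(p.1 i : ℝ)| ≤ M) ∧
          (∀ i, 1 ≤ p.2 i ∧ (p.2 i : ℝ) ≤ M) ∧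
          Function.Injective p.2 ∧
          p.1 ≠ 0 ∧
          |∑ i, (p.1 i : ℝ) * a (p.2 i)| ≤ K ∧
          ∑ i, p.1 i = 0} with hS
  have hcnt : Cnt S ((r.factorial : ℝ) *
      ((k + 1) * (C ^ (k + 1) * K ^ (k + 1) * M ^ k * Λ ^ (k + 1)) * 1)) := by
    have hperm : Cnt (Set.univ : Set (Equiv.Perm (Fin r))) (r.factorial : ℝ) :=
      ⟨Finset.univ, by simp, by simp [Fintype.card_perm]⟩
    refine Cnt.bind (fun σ : Equiv.Perm (Fin r) => {p | p ∈ S ∧ List.ofFn (fun i => (p.1 (σ i), p.2 (σ i))) ∈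
      NS a K M L (k + 1)}) hperm ?_ (by positivity) ?_
    · intro σ _
      refine Cnt.bind (fun l => {p | List.ofFn (fun i => (p.1 (σ i), p.2 (σ i))) = l}) hN ?_
        zero_le_one ?_
      · intro l _
        by_cases hne : ∃ p : (Fin r → ℤ) × (Fin r → ℕ),
            List.ofFn (fun i => (p.1 (σ i), p.2 (σ i))) = l
        · obtain ⟨p, rfl⟩ := hne
          refine (cnt_singleton p).mono ?_ le_rfl
          intro q hq
          have h := List.ofFn_injective (Set.mem_ofPred_eq ▸ hq)
          have h' : ∀ i, q.1 i = p.1 i ∧ q.2 i = p.2 i := by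
            intro i
            have := congrFun h (σ.symm i)
            simpa using this
          exact Prod.ext (funext fun i => (h' i).1) (funext fun i => (h' i).2)
        · refine (cnt_empty zero_le_one).mono ?_ le_rfl
          intro q hq
          exact hne ⟨q, hq⟩
      · rintro p ⟨-, hp⟩
        exact ⟨_, hp, rfl⟩
    · rintro p hp
      obtain ⟨h1, h2, h3, h4, h5, h6⟩ := id hp
      refine ⟨Tuple.sort p.2, trivial, hp, ?_⟩
      set σ := Tuple.sort p.2
      have hmono : StrictMono (p.2 ∘ σ) :=
        (Tuple.monotone_sort p.2).strictMono_of_injective (h3.comp σ.injective)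
      have hA : sumA a (List.ofFn (fun i => (p.1 (σ i), p.2 (σ i)))) =
          ∑ i, (p.1 i : ℝ) * a (p.2 i) := by
        rw [sumA, List.map_ofFn, List.sum_ofFn]
        exact Equiv.sum_comp σ (fun i => (p.1 i : ℝ) * a (p.2 i))
      have hY : sumY (List.ofFn (fun i => (p.1 (σ i), p.2 (σ i)))) = ∑ i, p.1 i := by
        rw [sumY, List.map_ofFn, List.sum_ofFn]
        exact Equiv.sum_comp σ (fun i => p.1 i)
      have hBd : ∀ q ∈ List.ofFn (fun i => (p.1 (σ i), p.2 (σ i))), Bd M q := by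
        intro q hq
        obtain ⟨i, rfl⟩ := List.mem_ofFn.1 hq
        exact ⟨h1 _, h2 _⟩
      refine ⟨List.length_ofFn, ?_, by rw [hA]; exact h5, by rw [hY]; exact h6, ?_⟩
      · refine feas_of hpos hpow hc hM L r hr hL _ 0 0 hBd ?_ (by rw [List.length_ofFn, Nat.zero_add]) ?_ ?_
        · rw [List.pairwise_ofFn]
          intro i j hij
          exact hmono hij
        · intro q hq
          exact (hpos _ (hBd q hq).2.1).le
        · rw [hA]; simpa using h5
      · obtain ⟨i, hi⟩ := Function.ne_iff.1 h4
        refine ⟨(p.1 (σ (σ.symm i)), p.2 (σ (σ.symm i))), List.mem_ofFn.2 ⟨σ.symm i, rfl⟩, ?_⟩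
        simpa using hi
  refine hcnt.ncard.trans (le_of_eq ?_)
  have e1 : M ^ ((r : ℝ) - 1 + ε) = M ^ k * (M ^ η) ^ (k + 1) := by
    rw [← Real.rpow_natCast M k, ← Real.rpow_natCast (M ^ η), ← Real.rpow_mul hM0.le,
      ← Real.rpow_add hM0]
    congr 1
    rw [hη, hrk]
    push_cast
    field_simp
    ring
  rw [e1, hΛ, mul_pow]
  ring
end

section
/- Let (a_n) be lacunary with constant c > 1 and k ≥ 2. For N ≥ 1 and ε > 0, the number of tuples (n, m, w, w') with n, m ∈ ℤ^{k-1}, w, w' ∈ ℤ^k, such that 1 ≤ w_1,...,w_k ≤ N are distinct, 1 ≤ w'_1,...,w'_k ≤ N are distinct, 1 ≤ ‖n‖_∞ ≤ N^{1+ε}, 1 ≤ ‖m‖_∞ ≤ N^{1+ε}, and |n·Δ(w) − m·Δ(w')| ≤ N^ε, is O(N^{2k−1+4kε}), where Δ(x) := (a_{x_1}−a_{x_2}, a_{x_2}−a_{x_3}, ..., a_{x_{k−1}}−a_{x_k}) for x = (x_1,...,x_k). -/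
section Aux
variable {ι : Type} [Fintype ι] [DecidableEq ι]

lemma lac_pow {c : ℝ} (hc : 1 < c) {a : ℕ → ℝ}
    (hlac : ∀ n ≥ 1, c * a n ≤ a (n + 1)) (n : ℕ) (hn : 1 ≤ n) (j : ℕ) :
    c ^ j * a n ≤ a (n + j) := by
  induction j with
  | zero => simp
  | succ j ih =>
    have h := hlac (n + j) (by omega)
    have : c ^ (j + 1) * a n = c * (c ^ j * a n) := by ring
    rw [this, ← add_assoc]
    exact (mul_le_mul_of_nonneg_left ih (by linarith)).trans h

lemma lac_lt {c : ℝ} (hc : 1 < c) {a : ℕ → ℝ} (hpos : ∀ n ≥ 1, 0 < a n)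
    (hlac : ∀ n ≥ 1, c * a n ≤ a (n + 1)) {m n : ℕ} (hm : 1 ≤ m) (h : m < n) :
    c * a m ≤ a n := by
  obtain ⟨j, rfl⟩ := Nat.exists_eq_add_of_lt h
  have h1 := lac_pow hc hlac m hm (j + 1)
  have h2 : c ≤ c ^ (j + 1) := le_self_pow₀ hc.le (by omega)
  have := mul_le_mul_of_nonneg_right h2 (hpos m hm).le
  rw [add_assoc]
  linarith

/-- Admissible pairs (positions, coefficients). -/
structure Adm (a : ℕ → ℝ) (J : Finset ι) (N B G : ℕ) (δ : ℝ) (u : ι → ℕ) (b : ι → ℤ) : Prop where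
  pos : ∀ i, 1 ≤ u i
  le : ∀ i, u i ≤ N
  bd : ∀ i, |b i| ≤ (B : ℤ)
  inj : ∀ i ∈ J, ∀ j ∈ J, u i = u j → i = j
  sum : ∑ i ∈ J, b i = 0
  nz : ∃ i ∈ J, b i ≠ 0
  la : ∀ (e : ℕ) (P : Finset ι), G < e → (∀ i, i ∉ P → b i ≠ 0 → u i + G ≤ e) →
    |∑ i ∈ P, (b i : ℝ) * a (u i)| ≤ δ * a e

/-- Combinatorial type of an admissible pair. -/
structure Compat (J : Finset ι) (G : ℕ) (u : ι → ℕ) (b : ι → ℤ)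
    (S : Finset ι) (i0 : ι) (D : Finset ι) (p : ι → Option ι) (p0 : Option (Option ι)) : Prop where
  hS : ∀ i, i ∈ S ↔ b i ≠ 0
  i0S : i0 ∈ S
  i0J : i0 ∈ J
  i0min : ∀ i ∈ S, i ∈ J → u i0 ≤ u i
  DS : ∀ d ∈ D, d ∈ S ∧ d ≠ i0
  Dinj : ∀ d ∈ D, ∀ d' ∈ D, u d = u d' → d = d'
  Dbig : ∀ d ∈ D, G < u d
  Dtail : ∀ d ∈ D, ∀ i ∈ S, i ≠ i0 → u i < u d → u i + G < u d
  pnone : ∀ i ∈ S, i ≠ i0 → p i = none → u i ≤ Fintype.card ι * G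
  psome : ∀ i ∈ S, i ≠ i0 → ∀ d, p i = some d → d ∈ D ∧ u d ≤ u i ∧ u i ≤ u d + Fintype.card ι * G
  p0none : p0 = none → G < u i0 ∧ ∀ i ∈ S, i ≠ i0 → u i + G < u i0 ∨ u i0 + G < u i
  p0bot : p0 = some none → u i0 ≤ G
  p0some : ∀ j, p0 = some (some j) → j ≠ i0 ∧ u i0 ≤ u j + G ∧ u j ≤ u i0 + G

lemma chain (u : ι → ℕ) (G : ℕ) (A : Finset ι) (i : ι) (hi : i ∈ A) :
    u i ≤ (A.filter (fun j => u j ≤ u i)).card * G ∨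
    ∃ d ∈ A, (G < u d ∧ ∀ j ∈ A, u j < u d → u j + G < u d) ∧ u d ≤ u i ∧
      u i ≤ u d + (A.filter (fun j => u j ≤ u i)).card * G := by
  induction h : u i using Nat.strong_induction_on generalizing i with
  | _ n ih =>
    subst h
    by_cases h1 : u i ≤ G
    · left
      have : 0 < (A.filter (fun j => u j ≤ u i)).card :=
        Finset.card_pos.2 ⟨i, by simp [hi]⟩
      nlinarith
    by_cases h2 : ∀ j ∈ A, u j < u i → u j + G < u i
    · right
      exact ⟨i, hi, ⟨by omega, h2⟩, le_rfl, by omega⟩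
    push Not at h2
    obtain ⟨j, hj, hji, hG⟩ := h2
    have hcard : (A.filter (fun l => u l ≤ u j)).card + 1 ≤ (A.filter (fun l => u l ≤ u i)).card := by
      apply Finset.card_lt_card
      refine ⟨fun l hl => ?_, fun hh => ?_⟩
      · simp only [Finset.mem_filter] at hl ⊢
        exact ⟨hl.1, by omega⟩
      · have := hh (show i ∈ _ by simp [hi])
        simp only [Finset.mem_filter] at this
        omega
    have hm := Nat.mul_le_mul_right G hcard
    rw [add_mul, one_mul] at hm
    rcases ih (u j) hji j hj rfl with h3 | ⟨d, hd, ht, hdj, hjd⟩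
    · left; omega
    · right; exact ⟨d, hd, ht, by omega, by omega⟩

lemma exists_type {a : ℕ → ℝ} {J : Finset ι} {N B G : ℕ} {δ : ℝ} {u : ι → ℕ} {b : ι → ℤ}
    (h : Adm a J N B G δ u b) : ∃ S i0 D p p0, Compat J G u b S i0 D p p0 := by
  classical
  obtain ⟨i1, hi1J, hi1⟩ := h.nz
  obtain ⟨i0, hi0, hmin⟩ := Finset.exists_min_image (J.filter (fun i => b i ≠ 0)) u
    ⟨i1, by simp [hi1J, hi1]⟩
  simp only [Finset.mem_filter] at hi0 hmin
  let S : Finset ι := Finset.univ.filter (fun i => b i ≠ 0)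
  let A := S.erase i0
  let tl := A.filter (fun d => G < u d ∧ ∀ j ∈ A, u j < u d → u j + G < u d)
  obtain ⟨D, hDs, hDim, hDinj⟩ : ∃ D ⊆ tl, tl.image u = D.image u ∧ Set.InjOn u D := by
    obtain ⟨D, h1, h2, h3⟩ := Finset.exists_subset_injOn_image_eq_of_surjOn tl
      (tl.image u) (by rw [Finset.coe_image]; exact Set.surjOn_image u _)
    exact ⟨D, by exact_mod_cast h1, h3.symm, h2⟩
  have key : ∀ i, ∃ q : Option ι, i ∈ A → (q = none → u i ≤ Fintype.card ι * G) ∧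
      ∀ d, q = some d → d ∈ D ∧ u d ≤ u i ∧ u i ≤ u d + Fintype.card ι * G := by
    intro i
    by_cases hi : i ∈ A
    · have hc : (A.filter (fun j => u j ≤ u i)).card * G ≤ Fintype.card ι * G :=
        Nat.mul_le_mul_right _ (Finset.card_le_univ _)
      rcases chain u G A i hi with h3 | ⟨d, hd, ht, hdj, hjd⟩
      · exact ⟨none, fun _ => ⟨fun _ => h3.trans hc, by simp⟩⟩
      · have : u d ∈ D.image u := by
          rw [← hDim]
          exact Finset.mem_image_of_mem _ (by simp only [tl, Finset.mem_filter]; exact ⟨hd, ht⟩)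
        obtain ⟨d', hd', he⟩ := Finset.mem_image.1 this
        refine ⟨some d', fun _ => ⟨by simp, ?_⟩⟩
        intro d2 hh2
        obtain rfl := Option.some.inj hh2
        exact ⟨hd', by omega, by omega⟩
    · exact ⟨none, fun h => absurd h hi⟩
  choose p hp using key
  have hA : ∀ i, i ∈ S → i ≠ i0 → i ∈ A := fun i h1 h2 => Finset.mem_erase.2 ⟨h2, h1⟩
  have hDtl : ∀ d ∈ D, d ∈ A ∧ G < u d ∧ ∀ j ∈ A, u j < u d → u j + G < u d := fun d hd => by
    have := hDs hd
    simpa only [tl, Finset.mem_filter] using this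
  obtain ⟨p0, hp0⟩ : ∃ p0 : Option (Option ι),
      (p0 = none → G < u i0 ∧ ∀ i ∈ S, i ≠ i0 → u i + G < u i0 ∨ u i0 + G < u i) ∧
      (p0 = some none → u i0 ≤ G) ∧
      (∀ j, p0 = some (some j) → j ≠ i0 ∧ u i0 ≤ u j + G ∧ u j ≤ u i0 + G) := by
    by_cases h1 : u i0 ≤ G
    · exact ⟨some none, by simp, fun _ => h1, by simp⟩
    by_cases h2 : ∀ i ∈ S, i ≠ i0 → u i + G < u i0 ∨ u i0 + G < u i
    · exact ⟨none, fun _ => ⟨by omega, h2⟩, by simp, by simp⟩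
    push Not at h2
    obtain ⟨j, hj, hj0, h3, h4⟩ := h2
    refine ⟨some (some j), by simp, by simp, ?_⟩
    intro j' h'
    simp only [Option.some.injEq] at h'
    subst h'
    exact ⟨hj0, h3, h4⟩
  refine ⟨S, i0, D, p, p0, ?_⟩
  constructor
  · intro i; simp [S]
  · simp [S, hi0.2]
  · exact hi0.1
  · intro i hi hJ
    exact hmin i ⟨hJ, by simpa [S] using hi⟩
  · intro d hd
    have := (hDtl d hd).1
    exact ⟨(Finset.mem_erase.1 this).2, (Finset.mem_erase.1 this).1⟩
  · intro d hd d' hd' he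
    exact hDinj hd hd' he
  · intro d hd; exact (hDtl d hd).2.1
  · intro d hd i hi hi0; exact (hDtl d hd).2.2 i (hA i hi hi0)
  · intro i hi hi0; exact (hp i (hA i hi hi0)).1
  · intro i hi hi0; exact (hp i (hA i hi hi0)).2
  · exact hp0.1
  · exact hp0.2.1
  · exact hp0.2.2


lemma fin_contra {c δ A X : ℝ} (hc : 1 < c) (hδ : 2 * δ * c < c - 1) {y : ℤ} (hy : y ≠ 0)
    (hA : 0 < A) (hX : c * X ≤ A) (h : |(y : ℝ) * (A - X)| ≤ 2 * δ * A) : False := by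
  have hy1 : (1 : ℝ) ≤ |(y : ℝ)| := by exact_mod_cast Int.one_le_abs hy
  have h1 : (c - 1) * A ≤ c * (A - X) := by linarith
  have h0 : 0 ≤ A - X := by
    have : 0 < (c - 1) * A := mul_pos (by linarith) hA
    by_contra hneg
    nlinarith
  rw [abs_mul, abs_of_nonneg h0] at h
  have h2 : A - X ≤ 2 * δ * A := by nlinarith
  have h3 : c * (A - X) ≤ c * (2 * δ * A) := by nlinarith
  nlinarith

section X
variable {c δ : ℝ} {a : ℕ → ℝ} {J : Finset ι} {N B G : ℕ} {u u' : ι → ℕ} {b b' : ι → ℤ}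
  {S D : Finset ι} {i0 : ι} {p : ι → Option ι} {p0 : Option (Option ι)}

lemma same_u (hc : 1 < c) (hδ : 2 * δ * c < c - 1) (hpos : ∀ n ≥ 1, 0 < a n)
    (hlac : ∀ n ≥ 1, c * a n ≤ a (n + 1))
    (h : Adm a J N B G δ u b) (h' : Adm a J N B G δ u b')
    (C : Compat J G u b S i0 D p p0)
    (hag : ∀ i, i ∉ D → i ≠ i0 → b i = b' i) : b = b' := by
  have hsum : ∑ i ∈ J, (b i - b' i) = 0 := by
    rw [Finset.sum_sub_distrib, h.sum, h'.sum, sub_zero]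
  have hD : ∀ d ∈ D, b d = b' d := by
    by_contra hcon
    push Not at hcon
    obtain ⟨d1, hd1, hne1⟩ := hcon
    obtain ⟨d, hd, hmax⟩ := Finset.exists_max_image (D.filter (fun i => b i ≠ b' i)) u
      ⟨d1, by simp [hd1, hne1]⟩
    simp only [Finset.mem_filter] at hd hmax
    obtain ⟨hdD, hdne⟩ := hd
    let P : Finset ι := Finset.univ.filter (fun i => u d ≤ u i + G)
    have hP : ∀ i, i ∉ P → u i + G ≤ u d := fun i hi => by
      simp only [P, Finset.mem_filter, Finset.mem_univ, true_and] at hi; omega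
    have e1 := h.la (u d) P (C.Dbig d hdD) (fun i hi _ => hP i hi)
    have e2 := h'.la (u d) P (C.Dbig d hdD) (fun i hi _ => hP i hi)
    have e3 : |∑ i ∈ P, ((b i - b' i : ℤ) : ℝ) * a (u i)| ≤ 2 * δ * a (u d) := by
      have : ∑ i ∈ P, ((b i - b' i : ℤ) : ℝ) * a (u i) =
          ∑ i ∈ P, (b i : ℝ) * a (u i) - ∑ i ∈ P, (b' i : ℝ) * a (u i) := by
        rw [← Finset.sum_sub_distrib]
        exact Finset.sum_congr rfl fun i _ => by push_cast; ring
      rw [this]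
      have := abs_sub (∑ i ∈ P, (b i : ℝ) * a (u i)) (∑ i ∈ P, (b' i : ℝ) * a (u i))
      linarith
    have hdP : d ∈ P := by simp [P]
    have hz : ∀ i ∈ P, i ≠ d ∧ i ≠ i0 → b i - b' i = 0 := by
      intro i hi hne
      by_cases hiD : i ∈ D
      · by_contra hy
        have hle := hmax i ⟨hiD, fun hh => hy (by omega)⟩
        rcases hle.lt_or_eq with hlt | heq
        · have := C.Dtail d hdD i (C.DS i hiD).1 hne.2 hlt
          simp only [P, Finset.mem_filter, Finset.mem_univ, true_and] at hi; omega
        · exact hne.1 (C.Dinj i hiD d hdD heq)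
      · rw [hag i hiD hne.2]; ring
    have hdi0 := (C.DS d hdD).2
    have hyd : b d - b' d ≠ 0 := sub_ne_zero.2 hdne
    have hpd := hpos (u d) (h.pos d)
    have done0 : ∀ X, X = 0 → ∑ i ∈ P, ((b i - b' i : ℤ) : ℝ) * a (u i) =
        ((b d - b' d : ℤ) : ℝ) * (a (u d) - X) → False := by
      intro X hX he
      rw [he] at e3
      exact fin_contra hc hδ hyd hpd (by rw [hX]; linarith) e3
    by_cases hi0P : i0 ∈ P
    · have s1 : ∑ i ∈ P, ((b i - b' i : ℤ) : ℝ) * a (u i) =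
          ((b d - b' d : ℤ) : ℝ) * a (u d) + ((b i0 - b' i0 : ℤ) : ℝ) * a (u i0) := by
        apply Finset.sum_eq_add_of_mem d i0 hdP hi0P hdi0
        intro i hi hne
        rw [hz i hi hne]; simp
      have hzJ : ∀ i ∈ J, i ≠ d ∧ i ≠ i0 → b i - b' i = 0 := by
        intro i hi hne
        by_cases hiD : i ∈ D
        · by_cases hiP : i ∈ P
          · exact hz i hiP hne
          · have := C.i0min i (C.DS i hiD).1 hi
            simp only [P, Finset.mem_filter, Finset.mem_univ, true_and] at hiP hi0P
            omega
        · rw [hag i hiD hne.2]; ring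
      by_cases hdJ : d ∈ J
      · have s2 := Finset.sum_eq_add_of_mem d i0 hdJ C.i0J hdi0 hzJ
        rw [hsum] at s2
        have s3 : b i0 - b' i0 = -(b d - b' d) := by omega
        have hlt : u i0 < u d := by
          rcases (C.i0min d (C.DS d hdD).1 hdJ).lt_or_eq with hlt | heq
          · exact hlt
          · exact absurd (h.inj i0 C.i0J d hdJ heq).symm hdi0
        have hl := lac_lt hc hpos hlac (h.pos i0) hlt
        have s4 : ∑ i ∈ P, ((b i - b' i : ℤ) : ℝ) * a (u i) =
            ((b d - b' d : ℤ) : ℝ) * (a (u d) - a (u i0)) := by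
          rw [s1, s3]; push_cast; ring
        rw [s4] at e3
        exact fin_contra hc hδ hyd hpd hl e3
      · have s2 := Finset.sum_eq_single_of_mem (f := fun i => b i - b' i) i0 C.i0J
          (fun i hi hne => hzJ i hi ⟨fun hh => hdJ (hh ▸ hi), hne⟩)
        rw [hsum] at s2
        refine done0 0 rfl ?_
        rw [s1, ← s2]; simp
    · refine done0 0 rfl ?_
      rw [Finset.sum_eq_single_of_mem d hdP]
      · simp
      · intro i hi hne
        rw [hz i hi ⟨hne, fun hh => hi0P (hh ▸ hi)⟩]; simp
  have hne : ∀ i, i ≠ i0 → b i = b' i := fun i hi => by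
    by_cases hiD : i ∈ D
    · exact hD i hiD
    · exact hag i hiD hi
  have s2 := Finset.sum_eq_single_of_mem (f := fun i => b i - b' i) i0 C.i0J
    (fun i _ h => by simp [hne i h])
  rw [hsum] at s2
  funext i
  by_cases hi : i = i0
  · subst hi; omega
  · exact hne i hi

lemma isolated_aux (hc : 1 < c) (hδ : 2 * δ * c < c - 1) (hpos : ∀ n ≥ 1, 0 < a n)
    (hlac : ∀ n ≥ 1, c * a n ≤ a (n + 1))
    (h : Adm a J N B G δ u b) (h' : Adm a J N B G δ u' b')
    (C : Compat J G u b S i0 D p none) (C' : Compat J G u' b' S i0 D p none)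
    (hu : ∀ i, i ≠ i0 → u i = u' i)
    (hag : ∀ i, i ∉ D → i ≠ i0 → b i = b' i) : u i0 ≤ u' i0 := by
  by_contra hlt
  push Not at hlt
  obtain ⟨hG, hiso⟩ := C.p0none rfl
  obtain ⟨hG', hiso'⟩ := C'.p0none rfl
  have hδ0 : 0 ≤ δ := by
    have := (abs_nonneg _).trans (h.la (u i0) Finset.univ hG (by simp))
    have h2 := hpos (u i0) (h.pos i0)
    by_contra hneg
    nlinarith
  have hsum : ∑ i ∈ J, (b i - b' i) = 0 := by
    rw [Finset.sum_sub_distrib, h.sum, h'.sum, sub_zero]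
  -- coefficients above agree
  have hD : ∀ d ∈ D, u i0 < u d → b d = b' d := by
    by_contra hcon
    push Not at hcon
    obtain ⟨d1, hd1, hd1u, hne1⟩ := hcon
    obtain ⟨d, hd, hmax⟩ := Finset.exists_max_image (D.filter (fun i => b i ≠ b' i)) u
      ⟨d1, by simp [hd1, hne1]⟩
    simp only [Finset.mem_filter] at hd hmax
    obtain ⟨hdD, hdne⟩ := hd
    have hdu : u i0 < u d := lt_of_lt_of_le hd1u (hmax d1 ⟨hd1, hne1⟩)
    have hdi0 := (C.DS d hdD).2
    have hdG : u i0 + G < u d := by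
      rcases hiso d (C.DS d hdD).1 hdi0 with h1 | h1 <;> omega
    let P : Finset ι := Finset.univ.filter (fun i => i ≠ i0 ∧ u d ≤ u i)
    have hPm : ∀ i, i ∈ P ↔ i ≠ i0 ∧ u d ≤ u i := fun i => by simp [P]
    have hP : ∀ i, i ∉ P → b i ≠ 0 → u i + G ≤ u d := fun i hi hb => by
      by_cases hi0 : i = i0
      · subst hi0; omega
      · have := C.Dtail d hdD i ((C.hS i).2 hb) hi0
        rw [hPm] at hi
        have : ¬ u d ≤ u i := fun hh => hi ⟨hi0, hh⟩
        omega
    have hP' : ∀ i, i ∉ P → b' i ≠ 0 → u' i + G ≤ u d := fun i hi hb => by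
      by_cases hi0 : i = i0
      · subst hi0; omega
      · rw [← hu i hi0]
        have := C.Dtail d hdD i ((C'.hS i).2 hb) hi0
        rw [hPm] at hi
        have : ¬ u d ≤ u i := fun hh => hi ⟨hi0, hh⟩
        omega
    have e1 := h.la (u d) P (C.Dbig d hdD) hP
    have e2 := h'.la (u d) P (C.Dbig d hdD) hP'
    have e3 : |∑ i ∈ P, ((b i - b' i : ℤ) : ℝ) * a (u i)| ≤ 2 * δ * a (u d) := by
      have : ∑ i ∈ P, ((b i - b' i : ℤ) : ℝ) * a (u i) =
          ∑ i ∈ P, (b i : ℝ) * a (u i) - ∑ i ∈ P, (b' i : ℝ) * a (u' i) := by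
        rw [← Finset.sum_sub_distrib]
        exact Finset.sum_congr rfl fun i hi => by
          rw [← hu i ((hPm i).1 hi).1]; push_cast; ring
      rw [this]
      have := abs_sub (∑ i ∈ P, (b i : ℝ) * a (u i)) (∑ i ∈ P, (b' i : ℝ) * a (u' i))
      linarith
    rw [Finset.sum_eq_single_of_mem d ((hPm d).2 ⟨hdi0, le_rfl⟩)] at e3
    · exact fin_contra hc hδ (sub_ne_zero.2 hdne) (hpos (u d) (h.pos d)) (X := 0)
        (by have := hpos (u d) (h.pos d); linarith) (by rw [sub_zero]; exact e3)
    · intro i hi hne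
      by_cases hiD : i ∈ D
      · by_cases hy : b i = b' i
        · simp [hy]
        · have h1 := hmax i ⟨hiD, hy⟩
          have h2 := ((hPm i).1 hi).2
          exact absurd (C.Dinj i hiD d hdD (by omega)) hne
      · simp [hag i hiD ((hPm i).1 hi).1]
  have hab : ∀ i, i ≠ i0 → u i0 < u i → b i = b' i := fun i hi hui => by
    by_cases hiD : i ∈ D
    · exact hD i hiD hui
    · exact hag i hiD hi
  have hβ : b i0 = b' i0 := by
    have s2 := Finset.sum_eq_single_of_mem (f := fun i => b i - b' i) i0 C.i0J
      (fun i hiJ hi => by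
        by_cases hiS : i ∈ S
        · have h1 := C.i0min i hiS hiJ
          rcases hiso i hiS hi with h2 | h2
          · omega
          · simp [hab i hi (by omega)]
        · have := (C.hS i).not.1 hiS
          have h3 := (C'.hS i).not.1 hiS
          push Not at this h3
          simp [this, h3])
    rw [hsum] at s2
    omega
  have hβ0 : b i0 ≠ 0 := (C.hS i0).1 C.i0S
  let Q : Finset ι := Finset.univ.filter (fun i => i ≠ i0 ∧ u i0 < u i)
  have hQm : ∀ i, i ∈ Q ↔ i ≠ i0 ∧ u i0 < u i := fun i => by simp [Q]
  have hi0Q : i0 ∉ Q := by simp [Q]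
  have hQ' : ∑ i ∈ Q, (b' i : ℝ) * a (u' i) = ∑ i ∈ Q, (b i : ℝ) * a (u i) :=
    Finset.sum_congr rfl fun i hi => by
      rw [hab i ((hQm i).1 hi).1 ((hQm i).1 hi).2, hu i ((hQm i).1 hi).1]
  have hlow : ∀ i, i ≠ i0 → i ∉ Q → i ∈ S → u i + G < u i0 := fun i hi hiQ hiS => by
    rw [hQm] at hiQ
    have : ¬ u i0 < u i := fun hh => hiQ ⟨hi, hh⟩
    rcases hiso i hiS hi with h1 | h1 <;> omega
  have e1 := h.la (u i0) (insert i0 Q) hG (fun i hi hb => by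
    simp only [Finset.mem_insert, not_or] at hi
    exact (hlow i hi.1 hi.2 ((C.hS i).2 hb)).le)
  rw [Finset.sum_insert hi0Q] at e1
  have hpx := hpos (u i0) (h.pos i0)
  set H := ∑ i ∈ Q, (b i : ℝ) * a (u i) with hH
  by_cases hz : u' i0 + G ≤ u i0
  · have e2 := h'.la (u i0) Q hG (fun i hi hb => by
      by_cases hi0 : i = i0
      · subst hi0; exact hz
      · rw [← hu i hi0]; exact (hlow i hi0 hi ((C'.hS i).2 hb)).le)
    rw [hQ'] at e2
    refine fin_contra hc hδ hβ0 hpx (X := 0) (by linarith) ?_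
    rw [sub_zero]
    have := abs_sub ((b i0 : ℝ) * a (u i0) + H) H
    rw [add_sub_cancel_right] at this
    linarith
  · have e2 := h'.la (u' i0) (insert i0 Q) hG' (fun i hi hb => by
      simp only [Finset.mem_insert, not_or] at hi
      have hiS := (C'.hS i).2 hb
      have h1 := hlow i hi.1 hi.2 hiS
      have h2 := hu i hi.1
      rcases hiso' i hiS hi.1 with h3 | h3 <;> omega)
    rw [Finset.sum_insert hi0Q, hQ', ← hβ] at e2
    have hl := lac_lt hc hpos hlac (h'.pos i0) hlt
    have hpz := hpos (u' i0) (h'.pos i0)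
    refine fin_contra hc hδ hβ0 hpx (X := a (u' i0)) hl ?_
    have := abs_sub ((b i0 : ℝ) * a (u i0) + H) ((b i0 : ℝ) * a (u' i0) + H)
    have hle : δ * a (u' i0) ≤ δ * a (u i0) :=
      mul_le_mul_of_nonneg_left (by nlinarith) hδ0
    have h5 : (b i0 : ℝ) * (a (u i0) - a (u' i0)) =
      ((b i0 : ℝ) * a (u i0) + H) - ((b i0 : ℝ) * a (u' i0) + H) := by ring
    rw [h5]
    linarith

/-- The big part of the code. -/
def bigC (S : Finset ι) (i0 : ι) (D : Finset ι) (u : ι → ℕ) (b : ι → ℤ) : ι → ℤ :=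
  fun i => if i = i0 then 0 else if i ∈ S ∧ i ∉ D then b i else u i

/-- Offset from a parent. -/
def off (u : ι → ℕ) (i : ι) : Option ι → ℤ
  | none => u i
  | some d => (u i : ℤ) - u d

/-- The small part of the code. -/
def smallC (S : Finset ι) (i0 : ι) (p : ι → Option ι) (p0 : Option (Option ι))
    (u : ι → ℕ) : ι → ℤ :=
  fun i => if i = i0 then (p0.elim 0 (off u i)) else if i ∈ S then off u i (p i) else 0

lemma code_inj (hc : 1 < c) (hδ : 2 * δ * c < c - 1) (hpos : ∀ n ≥ 1, 0 < a n)
    (hlac : ∀ n ≥ 1, c * a n ≤ a (n + 1))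
    (h : Adm a J N B G δ u b) (h' : Adm a J N B G δ u' b')
    (C : Compat J G u b S i0 D p p0) (C' : Compat J G u' b' S i0 D p p0)
    (hb : bigC S i0 D u b = bigC S i0 D u' b')
    (hs : smallC S i0 p p0 u = smallC S i0 p p0 u') : u = u' ∧ b = b' := by
  have hag : ∀ i, i ∉ D → i ≠ i0 → b i = b' i := by
    intro i hiD hi
    by_cases hiS : i ∈ S
    · have := congrFun hb i
      simpa [bigC, hi, hiS, hiD] using this
    · have h1 := (C.hS i).not.1 hiS
      have h3 := (C'.hS i).not.1 hiS
      push Not at h1 h3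
      rw [h1, h3]
  have hu1 : ∀ i, i ≠ i0 → ¬ (i ∈ S ∧ i ∉ D) → u i = u' i := by
    intro i hi hn
    have := congrFun hb i
    simp only [bigC, hi, hn, if_false] at this
    exact_mod_cast this
  have hu : ∀ i, i ≠ i0 → u i = u' i := by
    intro i hi
    by_cases hn : i ∈ S ∧ i ∉ D
    · have := congrFun hs i
      simp only [smallC, hi, hn.1, if_false, if_true] at this
      rcases hp : p i with _ | d
      · rw [hp] at this
        simp only [off] at this
        exact_mod_cast this
      · rw [hp] at this
        simp only [off] at this
        have hd := (C.psome i hn.1 hi d hp).1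
        have := hu1 d (C.DS d hd).2 (fun hh => hh.2 hd)
        omega
    · exact hu1 i hi hn
  have hu0 : u i0 = u' i0 := by
    have hs0 := congrFun hs i0
    simp only [smallC, if_true] at hs0
    rcases p0 with _ | _ | j
    · exact le_antisymm (isolated_aux hc hδ hpos hlac h h' C C' hu hag)
        (isolated_aux hc hδ hpos hlac h' h C' C (fun i hi => (hu i hi).symm)
          (fun i h1 h2 => (hag i h1 h2).symm))
    · simp only [Option.elim, off] at hs0
      exact_mod_cast hs0
    · simp only [Option.elim, off] at hs0
      have := hu j (C.p0some j rfl).1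
      omega
  have huu : u = u' := by
    funext i
    by_cases hi : i = i0
    · rw [hi, hu0]
    · exact hu i hi
  subst huu
  exact ⟨rfl, same_u hc hδ hpos hlac h h' C hag⟩

end X

abbrev Ty (ι : Type) := Finset ι × ι × Finset ι × (ι → Option ι) × Option (Option ι)

/-- Target set for codes of a given type. -/
noncomputable def codeSet (M L : ℕ) (i0 : ι) : Finset ((ι → ℤ) × (ι → ℤ)) :=
  (Fintype.piFinset (fun i => if i = i0 then {0} else Finset.Icc (-(M : ℤ)) M)) ×ˢ
    (Fintype.piFinset (fun _ => Finset.Icc (-(L : ℤ)) L))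

lemma card_codeSet (M L : ℕ) (i0 : ι) :
    (codeSet M L i0).card = (2 * M + 1) ^ (Fintype.card ι - 1) * (2 * L + 1) ^ (Fintype.card ι) := by
  have hI : ∀ M : ℕ, (Finset.Icc (-(M : ℤ)) M).card = 2 * M + 1 := fun M => by
    rw [Int.card_Icc]; omega
  rw [codeSet, Finset.card_product, Fintype.card_piFinset, Fintype.card_piFinset]
  congr 1
  · rw [← Finset.mul_prod_erase Finset.univ _ (Finset.mem_univ i0)]
    rw [Finset.prod_congr rfl (g := fun _ => 2 * M + 1)]
    · simp [Finset.card_erase_of_mem]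
    · intro i hi
      rw [if_neg (Finset.mem_erase.1 hi).1, hI]
  · simp only [hI, Finset.prod_const, Finset.card_univ]

lemma main_count {c δ : ℝ} {a : ℕ → ℝ} {J : Finset ι} {N B G M : ℕ}
    (hc : 1 < c) (hδ : 2 * δ * c < c - 1) (hpos : ∀ n ≥ 1, 0 < a n)
    (hlac : ∀ n ≥ 1, c * a n ≤ a (n + 1)) (hNM : N ≤ M) (hBM : B ≤ M) :
    {q : (ι → ℕ) × (ι → ℤ) | Adm a J N B G δ q.1 q.2}.Finite ∧
    {q : (ι → ℕ) × (ι → ℤ) | Adm a J N B G δ q.1 q.2}.ncard ≤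
      Fintype.card (Ty ι) * ((2 * M + 1) ^ (Fintype.card ι - 1) *
        (2 * (Fintype.card ι * G) + 1) ^ (Fintype.card ι)) := by
  classical
  have key : ∀ q : (ι → ℕ) × (ι → ℤ), ∃ τ : Option (Ty ι), Adm a J N B G δ q.1 q.2 →
      ∃ t, τ = some t ∧ Compat J G q.1 q.2 t.1 t.2.1 t.2.2.1 t.2.2.2.1 t.2.2.2.2 := by
    intro q
    by_cases h : Adm a J N B G δ q.1 q.2
    · obtain ⟨S, i0, D, p, p0, hC⟩ := exists_type h
      exact ⟨some (S, i0, D, p, p0), fun _ => ⟨_, rfl, hC⟩⟩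
    · exact ⟨none, fun hh => absurd hh h⟩
  choose ty hty using key
  let f : (ι → ℕ) × (ι → ℤ) → Option (Ty ι) × ((ι → ℤ) × (ι → ℤ)) := fun q =>
    (ty q, (ty q).elim (0, 0) (fun t =>
      (bigC t.1 t.2.1 t.2.2.1 q.1 q.2, smallC t.1 t.2.1 t.2.2.2.1 t.2.2.2.2 q.1)))
  let tgt : Finset (Option (Ty ι) × ((ι → ℤ) × (ι → ℤ))) :=
    Finset.univ.biUnion (fun t : Ty ι => {some t} ×ˢ codeSet M (Fintype.card ι * G) t.2.1)
  have hmap : ∀ q ∈ {q : (ι → ℕ) × (ι → ℤ) | Adm a J N B G δ q.1 q.2}, f q ∈ (tgt : Set _) := by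
    intro q hq
    have hq : Adm a J N B G δ q.1 q.2 := hq
    obtain ⟨t, ht, C⟩ := hty q hq
    have hcard : 1 ≤ Fintype.card ι := Fintype.card_pos_iff.2 ⟨t.2.1⟩
    have hGL : G ≤ Fintype.card ι * G := Nat.le_mul_of_pos_left G hcard
    simp only [tgt, Finset.coe_biUnion, Set.mem_iUnion, f, ht, Option.elim]
    refine ⟨t, by simp, ?_⟩
    simp only [codeSet, Finset.coe_product, Set.mem_prod, Finset.mem_coe, Finset.mem_singleton,
      Fintype.mem_piFinset, true_and]
    refine ⟨fun i => ?_, fun i => ?_⟩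
    · unfold bigC
      split_ifs with h1 h2
      · simp
      · have := abs_le.1 (hq.bd i)
        rw [Finset.mem_Icc]; omega
      · have := hq.le i
        rw [Finset.mem_Icc]; omega
    · generalize hL : Fintype.card ι * G = L at *
      unfold smallC
      rw [Finset.mem_Icc]
      split_ifs with h1 h2
      · subst h1
        rcases hp : t.2.2.2.2 with _ | _ | j
        · simp
        · have := C.p0bot hp
          simp only [Option.elim, off]; omega
        · have := C.p0some j hp
          simp only [Option.elim, off]; omega
      · rcases hp : t.2.2.2.1 i with _ | d
        · have := C.pnone i h2 h1 hp
          rw [hL] at this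
          simp only [off]; omega
        · have := C.psome i h2 h1 d hp
          rw [hL] at this
          simp only [off]; omega
      · omega
  have hinj : Set.InjOn f {q : (ι → ℕ) × (ι → ℤ) | Adm a J N B G δ q.1 q.2} := by
    intro q hq q' hq' he
    have hq : Adm a J N B G δ q.1 q.2 := hq
    have hq' : Adm a J N B G δ q'.1 q'.2 := hq'
    obtain ⟨t, ht, C⟩ := hty q hq
    obtain ⟨t', ht', C'⟩ := hty q' hq'
    simp only [f, ht, ht', Option.elim, Prod.mk.injEq, Option.some.injEq] at he
    obtain ⟨rfl, h1, h2⟩ := he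
    have := code_inj hc hδ hpos hlac hq hq' C C' h1 h2
    exact Prod.ext this.1 this.2
  refine ⟨Set.Finite.of_injOn hmap hinj tgt.finite_toSet, ?_⟩
  refine (Set.ncard_le_ncard_of_injOn f hmap hinj tgt.finite_toSet).trans ?_
  rw [Set.ncard_coe_finset]
  refine Finset.card_biUnion_le.trans ?_
  rw [Finset.sum_congr rfl (g := fun _ => ((2 * M + 1) ^ (Fintype.card ι - 1) *
        (2 * (Fintype.card ι * G) + 1) ^ (Fintype.card ι)))]
  · simp
  · intro t _
    rw [Finset.card_product, card_codeSet]; simp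

end Aux

section Fin
variable {m : ℕ}

/-- Coefficients after summation by parts. -/
def bco (n : Fin m → ℤ) : Fin (m + 1) → ℤ :=
  fun j => (Fin.snoc n 0 : Fin (m + 1) → ℤ) j - (Fin.cons 0 n : Fin (m + 1) → ℤ) j

lemma bco_sum (n : Fin m → ℤ) (x : Fin (m + 1) → ℝ) :
    ∑ j, (bco n j : ℝ) * x j = ∑ i : Fin m, (n i : ℝ) * (x i.castSucc - x i.succ) := by
  have h1 : ∑ j, ((Fin.snoc n 0 : Fin (m + 1) → ℤ) j : ℝ) * x j =
      ∑ i : Fin m, (n i : ℝ) * x i.castSucc := by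
    rw [Fin.sum_univ_castSucc]; simp
  have h2 : ∑ j, ((Fin.cons 0 n : Fin (m + 1) → ℤ) j : ℝ) * x j =
      ∑ i : Fin m, (n i : ℝ) * x i.succ := by
    rw [Fin.sum_univ_succ]; simp
  simp only [bco, Int.cast_sub, sub_mul, mul_sub, Finset.sum_sub_distrib, h1, h2]

lemma bco_zero (n : Fin m → ℤ) : ∑ j, bco n j = 0 := by
  have := bco_sum n (fun _ => 1)
  simp only [mul_one, sub_self, mul_zero, Finset.sum_const_zero] at this
  exact_mod_cast this

lemma bco_rec (n : Fin m → ℤ) (i : Fin m) :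
    (n i : ℝ) = ∑ j, (bco n j : ℝ) * (if j.val ≤ i.val then 1 else 0) := by
  rw [bco_sum n (fun j => if j.val ≤ i.val then 1 else 0)]
  rw [Finset.sum_eq_single_of_mem i (Finset.mem_univ i)]
  · simp
  · intro j _ hj
    have : j.val ≠ i.val := fun h => hj (Fin.ext h)
    by_cases h : j.val ≤ i.val
    · have h2 : j.val + 1 ≤ i.val := by omega
      simp [h, h2]
    · have h2 : ¬ j.val + 1 ≤ i.val := by omega
      simp [h, h2]

lemma bco_inj {n n' : Fin m → ℤ} (h : bco n = bco n') : n = n' := by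
  funext i
  have h1 := bco_rec n i
  rw [h, ← bco_rec n' i] at h1
  exact_mod_cast h1

lemma bco_bd (n : Fin m → ℤ) {T : ℝ} (hT : 0 ≤ T) (h : ∀ i, |(n i : ℝ)| ≤ T) (j : Fin (m + 1)) :
    |(bco n j : ℝ)| ≤ 2 * T := by
  have h1 : |((Fin.snoc n 0 : Fin (m + 1) → ℤ) j : ℝ)| ≤ T := by
    refine Fin.lastCases ?_ (fun i => ?_) j
    · simpa using hT
    · simpa using h i
  have h2 : |((Fin.cons 0 n : Fin (m + 1) → ℤ) j : ℝ)| ≤ T := by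
    refine Fin.cases ?_ (fun i => ?_) j
    · simpa using hT
    · simpa using h i
  have := abs_sub ((Fin.snoc n 0 : Fin (m + 1) → ℤ) j : ℝ) ((Fin.cons 0 n : Fin (m + 1) → ℤ) j : ℝ)
  simp only [bco, Int.cast_sub]
  linarith

end Fin

lemma exists_G {c ε R0 : ℝ} (hc : 1 < c) (hε : 0 < ε) (hR : 0 < R0) :
    ∃ K : ℝ, 0 < K ∧ ∀ N : ℕ, 1 ≤ N →
      ∃ G : ℕ, (G : ℝ) ≤ K * (N : ℝ) ^ ε ∧ R0 * (N : ℝ) ^ (1 + ε) ≤ c ^ G := by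
  have hlc : 0 < Real.log c := Real.log_pos hc
  set A := (|Real.log R0| + (1 + ε) / ε) / Real.log c with hA
  have hA0 : 0 < A := by positivity
  refine ⟨A + 1, by linarith, fun N hN => ?_⟩
  have hN1 : (1 : ℝ) ≤ N := by exact_mod_cast hN
  have hNe : (1 : ℝ) ≤ (N : ℝ) ^ ε := Real.one_le_rpow hN1 hε.le
  refine ⟨⌈A * (N : ℝ) ^ ε⌉₊, ?_, ?_⟩
  · have := Nat.ceil_lt_add_one (show 0 ≤ A * (N : ℝ) ^ ε by positivity)
    linarith
  · have h1 : A * (N : ℝ) ^ ε ≤ (⌈A * (N : ℝ) ^ ε⌉₊ : ℝ) := Nat.le_ceil _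
    have hlog : Real.log N ≤ (N : ℝ) ^ ε / ε := Real.log_le_rpow_div (by positivity) hε
    have hNp : (0 : ℝ) < N := by linarith
    rw [← Real.log_le_log_iff (by positivity) (by positivity), Real.log_mul (by positivity)
      (by positivity), Real.log_rpow hNp, Real.log_pow]
    have h2 := mul_le_mul_of_nonneg_right h1 hlc.le
    have h3 : A * (N : ℝ) ^ ε * Real.log c = (|Real.log R0| + (1 + ε) / ε) * (N : ℝ) ^ ε := by
      rw [hA]; field_simp
    have h4 : |Real.log R0| ≤ |Real.log R0| * (N : ℝ) ^ ε :=
      le_mul_of_one_le_right (abs_nonneg _) hNe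
    have h5 : (1 + ε) * Real.log N ≤ (1 + ε) * ((N : ℝ) ^ ε / ε) :=
      mul_le_mul_of_nonneg_left hlog (by linarith)
    have h6 : (1 + ε) / ε * (N : ℝ) ^ ε = (1 + ε) * ((N : ℝ) ^ ε / ε) := by ring
    have h7 := le_abs_self (Real.log R0)
    rw [add_mul, h6] at h3
    linarith

lemma la_of {ι : Type} [Fintype ι] [DecidableEq ι] {c δ V T : ℝ} {a : ℕ → ℝ} {G : ℕ}
    {u : ι → ℕ} {b : ι → ℤ}
    (hc : 1 < c) (hpos : ∀ n ≥ 1, 0 < a n)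
    (hlac : ∀ n ≥ 1, c * a n ≤ a (n + 1)) (hδ : 0 < δ) (hT : 0 ≤ T)
    (hu : ∀ i, 1 ≤ u i) (hb : ∀ i, |(b i : ℝ)| ≤ 2 * T)
    (hV : |∑ i, (b i : ℝ) * a (u i)| ≤ V)
    (h1 : Fintype.card ι * (2 * T) ≤ δ / 2 * c ^ G) (h2 : V ≤ δ / 2 * (c ^ G * a 1))
    (e : ℕ) (P : Finset ι) (he : G < e) (hP : ∀ i, i ∉ P → b i ≠ 0 → u i + G ≤ e) :
    |∑ i ∈ P, (b i : ℝ) * a (u i)| ≤ δ * a e := by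
  have hcG : 0 < c ^ G := by positivity
  have hmono : ∀ n ≥ 1, ∀ j, a n ≤ a (n + j) := fun n hn j => by
    have := lac_pow hc hlac n hn j
    have h3 : 1 ≤ c ^ j := one_le_pow₀ hc.le
    have := hpos n hn
    nlinarith
  have hgap : ∀ n ≥ 1, n + G ≤ e → c ^ G * a n ≤ a e := fun n hn h => by
    obtain ⟨j, rfl⟩ := Nat.exists_eq_add_of_le h
    exact (lac_pow hc hlac n hn G).trans (hmono (n + G) (by omega) j)
  have hae := hpos e (by omega)
  have hV2 : V ≤ δ / 2 * a e :=
    h2.trans (mul_le_mul_of_nonneg_left (hgap 1 le_rfl (by omega)) (by linarith))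
  have hsplit := Finset.sum_add_sum_compl P (fun i => (b i : ℝ) * a (u i))
  have hcompl : |∑ i ∈ Pᶜ, (b i : ℝ) * a (u i)| ≤ δ / 2 * a e := by
    have hterm : ∀ i ∈ Pᶜ, |(b i : ℝ) * a (u i)| ≤ 2 * T * (a e / c ^ G) := by
      intro i hi
      rw [abs_mul, abs_of_pos (hpos _ (hu i))]
      by_cases hbi : b i = 0
      · rw [hbi]; simp only [Int.cast_zero, abs_zero, zero_mul]; positivity
      · have h3 := hgap (u i) (hu i) (hP i (Finset.mem_compl.1 hi) hbi)
        have h4 : a (u i) ≤ a e / c ^ G := by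
          rw [le_div_iff₀ hcG]; linarith
        exact mul_le_mul (hb i) h4 (hpos _ (hu i)).le (by linarith)
    have h3 := (Finset.abs_sum_le_sum_abs _ _).trans (Finset.sum_le_sum hterm)
    rw [Finset.sum_const, nsmul_eq_mul] at h3
    have h4 : ((Pᶜ).card : ℝ) ≤ Fintype.card ι := by exact_mod_cast Finset.card_le_univ _
    have h5 : ((Pᶜ).card : ℝ) * (2 * T * (a e / c ^ G)) ≤
        Fintype.card ι * (2 * T * (a e / c ^ G)) :=
      mul_le_mul_of_nonneg_right h4 (by positivity)
    have h6 : Fintype.card ι * (2 * T * (a e / c ^ G)) ≤ δ / 2 * a e := by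
      have := mul_le_mul_of_nonneg_right h1 (show 0 ≤ a e / c ^ G by positivity)
      have h7 : δ / 2 * c ^ G * (a e / c ^ G) = δ / 2 * a e := by field_simp
      rw [h7] at this
      linarith
    linarith
  have h8 : ∑ i ∈ P, (b i : ℝ) * a (u i) =
      ∑ i, (b i : ℝ) * a (u i) - ∑ i ∈ Pᶜ, (b i : ℝ) * a (u i) := by linarith
  rw [h8]
  have := abs_sub (∑ i, (b i : ℝ) * a (u i)) (∑ i ∈ Pᶜ, (b i : ℝ) * a (u i))
  linarith

lemma final (c : ℝ) (hc : 1 < c) (a : ℕ → ℝ) (ha1 : 0 < a 1)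
    (hpos : ∀ n ≥ 1, 0 < a n) (hlac : ∀ n ≥ 1, c * a n ≤ a (n + 1))
    (m : ℕ) (ε : ℝ) (hε : 0 < ε) :
    ∃ K0 : ℝ, 0 < K0 ∧ ∀ N : ℕ, 1 ≤ N →
      ({q : ((Fin m → ℤ) × (Fin m → ℤ)) × ((Fin (m + 1) → ℕ) × (Fin (m + 1) → ℕ)) |
          (∀ i, 1 ≤ q.2.1 i ∧ q.2.1 i ≤ N) ∧ Function.Injective q.2.1 ∧
          (∀ i, 1 ≤ q.2.2 i ∧ q.2.2 i ≤ N) ∧ Function.Injective q.2.2 ∧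
          1 ≤ ‖(fun i => (q.1.1 i : ℝ))‖ ∧
          ‖(fun i => (q.1.1 i : ℝ))‖ ≤ (N : ℝ) ^ ((1 : ℝ) + ε) ∧
          1 ≤ ‖(fun i => (q.1.2 i : ℝ))‖ ∧
          ‖(fun i => (q.1.2 i : ℝ))‖ ≤ (N : ℝ) ^ ((1 : ℝ) + ε) ∧
          |(∑ i : Fin m, (q.1.1 i : ℝ) * (a (q.2.1 i.castSucc) - a (q.2.1 i.succ))) -
            ∑ i : Fin m, (q.1.2 i : ℝ) * (a (q.2.2 i.castSucc) - a (q.2.2 i.succ))| ≤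
            (N : ℝ) ^ (ε : ℝ)}.ncard : ℝ) ≤
        K0 * (N : ℝ) ^ (2 * ((m + 1 : ℕ) : ℝ) - 1 + 4 * ((m + 1 : ℕ) : ℝ) * ε) := by
  classical
  let ι := Fin (m + 1) ⊕ Fin (m + 1)
  have hcι : Fintype.card ι = 2 * m + 2 := by simp [ι]; ring
  set δ : ℝ := (c - 1) / (4 * c) with hδdef
  have hδ0 : 0 < δ := div_pos (by linarith) (by linarith)
  have hδ : 2 * δ * c < c - 1 := by
    have : 2 * δ * c = (c - 1) / 2 := by rw [hδdef]; field_simp; ring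
    linarith
  set R0 : ℝ := (2 * m + 2) * 4 / δ + 2 / (δ * a 1) with hR0
  have hR0p : 0 < R0 := by positivity
  obtain ⟨K, hK, hG⟩ := exists_G hc hε hR0p
  set C1 : ℝ := ((Fintype.card (Ty ι) : ℕ) : ℝ) with hC1
  set K' : ℝ := 2 * ((2 * m + 2) * K) + 1 with hK'
  refine ⟨(C1 + 1) * (5 ^ (2 * m + 1) * K' ^ (2 * m + 2)), by positivity, fun N hN => ?_⟩
  obtain ⟨G, hGle, hGbig⟩ := hG N hN
  have hN1 : (1 : ℝ) ≤ N := by exact_mod_cast hN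
  have hNp : (0 : ℝ) < N := by linarith
  have hV1 : (1 : ℝ) ≤ (N : ℝ) ^ ε := Real.one_le_rpow hN1 hε.le
  set T : ℝ := (N : ℝ) ^ (1 + ε) with hT
  set V : ℝ := (N : ℝ) ^ ε with hV
  have hTV : T = N * V := by rw [hT, Real.rpow_add hNp, Real.rpow_one]
  have hNT : (N : ℝ) ≤ T := by rw [hTV]; nlinarith
  have hVT : V ≤ T := by rw [hTV]; nlinarith
  have hT1 : 1 ≤ T := hN1.trans hNT
  set M : ℕ := ⌊2 * T⌋₊ with hM
  have hMle : (M : ℝ) ≤ 2 * T := Nat.floor_le (by linarith)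
  have hNM : N ≤ M := Nat.le_floor (by linarith)
  let J : Finset ι := Finset.univ.map Function.Embedding.inr
  have hmain := main_count (ι := ι) (J := J) (N := N) (B := M) (G := G) (M := M)
    hc hδ hpos hlac hNM le_rfl
  let g : ((Fin m → ℤ) × (Fin m → ℤ)) × ((Fin (m + 1) → ℕ) × (Fin (m + 1) → ℕ)) →
      (ι → ℕ) × (ι → ℤ) := fun q =>
    (Sum.elim q.2.1 q.2.2, Sum.elim (bco q.1.1) (fun j => - bco q.1.2 j))
  have hginj : Function.Injective g := by
    rintro ⟨⟨n, n'⟩, w, w'⟩ ⟨⟨n1, n1'⟩, w1, w1'⟩ he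
    have he1 := congrArg Prod.fst he
    have he2 := congrArg Prod.snd he
    have h1 : w = w1 := funext fun j => congrFun he1 (Sum.inl j)
    have h2 : w' = w1' := funext fun j => congrFun he1 (Sum.inr j)
    have h3 : bco n = bco n1 := funext fun j => congrFun he2 (Sum.inl j)
    have h5 : bco n' = bco n1' := funext fun j => neg_injective (congrFun he2 (Sum.inr j))
    rw [bco_inj h3, bco_inj h5, h1, h2]
  have hle := Set.ncard_le_ncard_of_injOn (s := {q : ((Fin m → ℤ) × (Fin m → ℤ)) × ((Fin (m + 1) → ℕ) × (Fin (m + 1) → ℕ)) |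
          (∀ i, 1 ≤ q.2.1 i ∧ q.2.1 i ≤ N) ∧ Function.Injective q.2.1 ∧
          (∀ i, 1 ≤ q.2.2 i ∧ q.2.2 i ≤ N) ∧ Function.Injective q.2.2 ∧
          1 ≤ ‖(fun i => (q.1.1 i : ℝ))‖ ∧
          ‖(fun i => (q.1.1 i : ℝ))‖ ≤ T ∧
          1 ≤ ‖(fun i => (q.1.2 i : ℝ))‖ ∧
          ‖(fun i => (q.1.2 i : ℝ))‖ ≤ T ∧
          |(∑ i : Fin m, (q.1.1 i : ℝ) * (a (q.2.1 i.castSucc) - a (q.2.1 i.succ))) -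
            ∑ i : Fin m, (q.1.2 i : ℝ) * (a (q.2.2 i.castSucc) - a (q.2.2 i.succ))| ≤ V})
    g (t := {q : (ι → ℕ) × (ι → ℤ) | Adm a J N M G δ q.1 q.2}) ?_ hginj.injOn hmain.1
  · have hle2 := hle.trans hmain.2
    have hle3 : ((Set.ncard _ : ℕ) : ℝ) ≤ _ := Nat.cast_le.2 hle2
    refine hle3.trans ?_
    rw [hcι]
    push_cast
    have b1 : (2 * (M : ℝ) + 1) ^ (2 * m + 1) ≤ (5 * T) ^ (2 * m + 1) :=
      pow_le_pow_left₀ (by positivity) (by linarith) _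
    have b2 : (2 * ((2 * (m : ℝ) + 2) * G) + 1) ^ (2 * m + 2) ≤ (K' * V) ^ (2 * m + 2) := by
      apply pow_le_pow_left₀ (by positivity)
      have : (2 * (m : ℝ) + 2) * G ≤ (2 * (m : ℝ) + 2) * (K * V) :=
        mul_le_mul_of_nonneg_left hGle (by positivity)
      rw [hK', add_mul]
      linarith
    have b3 : T ^ (2 * m + 1) * V ^ (2 * m + 2) ≤
        (N : ℝ) ^ (2 * ((m : ℝ) + 1) - 1 + 4 * ((m : ℝ) + 1) * ε) := by
      rw [hT, hV, ← Real.rpow_natCast, ← Real.rpow_natCast, ← Real.rpow_mul hNp.le,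
        ← Real.rpow_mul hNp.le, ← Real.rpow_add hNp]
      apply Real.rpow_le_rpow_of_exponent_le hN1
      push_cast
      nlinarith
    have b4 := mul_le_mul b1 b2 (by positivity) (by positivity)
    rw [mul_pow, mul_pow] at b4
    have hC10 : 0 ≤ C1 := by positivity
    have hP : 0 ≤ (5 : ℝ) ^ (2 * m + 1) * K' ^ (2 * m + 2) := by positivity
    calc _ ≤ C1 * (5 ^ (2 * m + 1) * T ^ (2 * m + 1) * (K' ^ (2 * m + 2) * V ^ (2 * m + 2))) :=
          mul_le_mul_of_nonneg_left b4 hC10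
      _ = C1 * (5 ^ (2 * m + 1) * K' ^ (2 * m + 2)) * (T ^ (2 * m + 1) * V ^ (2 * m + 2)) := by ring
      _ ≤ (C1 + 1) * (5 ^ (2 * m + 1) * K' ^ (2 * m + 2)) * (T ^ (2 * m + 1) * V ^ (2 * m + 2)) := by
          apply mul_le_mul_of_nonneg_right _ (by positivity)
          apply mul_le_mul_of_nonneg_right _ hP
          linarith
      _ ≤ _ := mul_le_mul_of_nonneg_left b3 (by positivity)
  · rintro ⟨⟨n, n'⟩, w, w'⟩ ⟨hw, hwi, hw', hwi', hn1, hnT, hn1', hnT', hsum⟩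
    simp only at hw hwi hw' hwi' hn1 hnT hn1' hnT' hsum
    have hT0 : 0 ≤ T := by linarith
    have hnb : ∀ i, |(n i : ℝ)| ≤ T := fun i => by
      have := norm_le_pi_norm (fun i => (n i : ℝ)) i
      simp only [Real.norm_eq_abs] at this
      exact this.trans hnT
    have hnb' : ∀ i, |(n' i : ℝ)| ≤ T := fun i => by
      have := norm_le_pi_norm (fun i => (n' i : ℝ)) i
      simp only [Real.norm_eq_abs] at this
      exact this.trans hnT'
    let u : ι → ℕ := Sum.elim w w'
    let b : ι → ℤ := Sum.elim (bco n) (fun j => - bco n' j)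
    have hu1 : ∀ i, 1 ≤ u i := by
      rintro (i | i)
      · exact (hw i).1
      · exact (hw' i).1
    have hbT : ∀ i, |(b i : ℝ)| ≤ 2 * T := by
      rintro (i | i)
      · exact bco_bd n hT0 hnb i
      · simp only [b, Sum.elim_inr, Int.cast_neg, abs_neg]
        exact bco_bd n' hT0 hnb' i
    show Adm a J N M G δ u b
    constructor
    · exact hu1
    · rintro (i | i)
      · exact (hw i).2
      · exact (hw' i).2
    · intro i
      have h1 := hbT i
      have h2 : ((b i).natAbs : ℝ) ≤ 2 * T := by
        rw [Nat.cast_natAbs]; exact_mod_cast h1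
      have h3 : (b i).natAbs ≤ M := Nat.le_floor h2
      rw [Int.abs_eq_natAbs]
      exact_mod_cast h3
    · intro i hi j hj he
      simp only [J, Finset.mem_map, Finset.mem_univ, true_and] at hi hj
      obtain ⟨i, rfl⟩ := hi
      obtain ⟨j, rfl⟩ := hj
      rw [hwi' he]
    · simp only [J, Finset.sum_map]
      show ∑ x, -bco n' x = 0
      rw [Finset.sum_neg_distrib, bco_zero, neg_zero]
    · by_contra hcon
      push Not at hcon
      have hz : ∀ j, bco n' j = 0 := fun j => by
        have := hcon (Sum.inr j) (Finset.mem_map.2 ⟨j, Finset.mem_univ j, rfl⟩)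
        simpa [b] using this
      have hn0 : (fun i => (n' i : ℝ)) = 0 := by
        funext i
        rw [bco_rec n' i]
        simp [hz]
      rw [hn0, norm_zero] at hn1'
      linarith
    · intro e P he hP
      have hs : ∑ i, (b i : ℝ) * a (u i) =
          (∑ i : Fin m, (n i : ℝ) * (a (w i.castSucc) - a (w i.succ))) -
            ∑ i : Fin m, (n' i : ℝ) * (a (w' i.castSucc) - a (w' i.succ)) := by
        rw [← bco_sum n (fun j => a (w j)), ← bco_sum n' (fun j => a (w' j))]
        simp [ι, u, b, Fintype.sum_sum_type, sub_eq_add_neg]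
      have g1 : (2 * (m : ℝ) + 2) * 4 / δ * T ≤ c ^ G := by
        refine le_trans (mul_le_mul_of_nonneg_right ?_ hT0) hGbig
        have : 0 < 2 / (δ * a 1) := by positivity
        linarith
      have g2 : 2 / (δ * a 1) * T ≤ c ^ G := by
        refine le_trans (mul_le_mul_of_nonneg_right ?_ hT0) hGbig
        have : 0 < (2 * (m : ℝ) + 2) * 4 / δ := by positivity
        linarith
      refine la_of (V := V) hc hpos hlac hδ0 hT0 hu1 hbT (by rw [hs]; exact hsum) ?_ ?_ e P he hP
      · rw [hcι]
        have := mul_le_mul_of_nonneg_left g1 (show 0 ≤ δ / 2 by linarith)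
        have h9 : δ / 2 * ((2 * (m : ℝ) + 2) * 4 / δ * T) = (2 * m + 2) * (2 * T) := by
          field_simp; ring
        push_cast
        linarith
      · have := mul_le_mul_of_nonneg_left g2 (show 0 ≤ δ / 2 * a 1 by positivity)
        have h9 : δ / 2 * a 1 * (2 / (δ * a 1) * T) = T := by
          field_simp
        have h10 : δ / 2 * (c ^ G * a 1) = δ / 2 * a 1 * c ^ G := by ring
        linarith

theorem stmt7 (c : ℝ) (hc : 1 < c) (a : ℕ → ℝ) (ha1 : 0 < a 1)
    (hpos : ∀ n ≥ 1, 0 < a n) (hlac : ∀ n ≥ 1, c * a n ≤ a (n + 1))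
    (k : ℕ) (hk : 2 ≤ k) (ε : ℝ) (hε : 0 < ε) :
    ∃ K0 : ℝ, 0 < K0 ∧ ∀ N : ℕ, 1 ≤ N →
      ({q : ((Fin (k - 1) → ℤ) × (Fin (k - 1) → ℤ)) × ((Fin k → ℕ) × (Fin k → ℕ)) |
          (∀ i, 1 ≤ q.2.1 i ∧ q.2.1 i ≤ N) ∧ Function.Injective q.2.1 ∧
          (∀ i, 1 ≤ q.2.2 i ∧ q.2.2 i ≤ N) ∧ Function.Injective q.2.2 ∧
          1 ≤ ‖(fun i => (q.1.1 i : ℝ))‖ ∧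
          ‖(fun i => (q.1.1 i : ℝ))‖ ≤ (N : ℝ) ^ ((1 : ℝ) + ε) ∧
          1 ≤ ‖(fun i => (q.1.2 i : ℝ))‖ ∧
          ‖(fun i => (q.1.2 i : ℝ))‖ ≤ (N : ℝ) ^ ((1 : ℝ) + ε) ∧
          |(∑ i : Fin (k - 1), (q.1.1 i : ℝ) *
              (a (q.2.1 ⟨i.1, by have := i.2; omega⟩) - a (q.2.1 ⟨i.1 + 1, by have := i.2; omega⟩))) -
            ∑ i : Fin (k - 1), (q.1.2 i : ℝ) *
              (a (q.2.2 ⟨i.1, by have := i.2; omega⟩) - a (q.2.2 ⟨i.1 + 1, by have := i.2; omega⟩))| ≤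
            (N : ℝ) ^ (ε : ℝ)}.ncard : ℝ) ≤
        K0 * (N : ℝ) ^ (2 * (k : ℝ) - 1 + 4 * (k : ℝ) * ε) := by
  obtain ⟨m, rfl⟩ : ∃ m, k = m + 1 := ⟨k - 1, by omega⟩
  exact final c hc a ha1 hpos hlac m ε hε
end
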